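/- arXiv:1312.4030 — 2 statements merged into one kernel-verified Lean document; each statement's English description precedes it below -/
import Mathlib

section
/- Let β, γ ∈ ℂ be constants and consider the Hamiltonian system y₁' = y₂² + z y₁ + γ, y₂' = −y₁² − z y₂ − β. Let γ₀ be a finite-length curve with endpoint z_∞ ∈ ℂ such that a solution (y₁, y₂) can be analytically continued along γ₀ up to, but not including, z_∞. Then z_∞ is a simple pole of both y₁ and y₂: the solution is represented near z_∞ by convergent Laurent series y₁(z) = Σ_{k≥−1} C_{1,k}(z−z_∞)^k and y₂(z) = Σ_{k≥−1} C_{2,k}(z−z_∞)^k with C_{1,−1}³ = −1 and C_{2,−1} = C_{1,−1}². In particular, every local solution of the system extends to a pair of functions meromorphic on the whole complex plane, i.e. the system has the Painlevé property. -/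
open scoped Topology
open Metric


noncomputable def qc {ι : Type} {T : ℕ} (coef : ι → Fin T → ℂ) (J K : ι → Fin T → ι)
    (x : ι → ℂ) : ℕ → ι → ℂ
  | 0 => x
  | n + 1 => fun i => (1 / ((n : ℂ) + 1)) * ∑ m, coef i m *
      ∑ p : Fin (n + 1), qc coef J K x p.1 (J i m) * qc coef J K x (n - p.1) (K i m)
  termination_by n => n
  decreasing_by
    · have := p.2; omega
    · omega

theorem qc_succ {ι : Type} {T : ℕ} (coef : ι → Fin T → ℂ) (J K : ι → Fin T → ι)
    (x : ι → ℂ) (n : ℕ) (i : ι) :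
    ((n : ℂ) + 1) * qc coef J K x (n + 1) i = ∑ m, coef i m *
      ∑ p ∈ Finset.range (n + 1), qc coef J K x p (J i m) * qc coef J K x (n - p) (K i m) := by
  have hn : (n : ℂ) + 1 ≠ 0 := by exact_mod_cast Nat.succ_ne_zero n
  rw [qc]
  rw [← mul_assoc, mul_one_div_cancel hn, one_mul]
  refine Finset.sum_congr rfl fun m _ => ?_
  rw [← Fin.sum_univ_eq_sum_range
    (fun p => qc coef J K x p (J i m) * qc coef J K x (n - p) (K i m)) (n + 1)]

theorem qc_bound {ι : Type} {T : ℕ} (coef : ι → Fin T → ℂ) (J K : ι → Fin T → ι)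
    (x : ι → ℂ) (C A : ℝ) (hC : 0 < C) (hcoef : ∀ i, ∑ m, ‖coef i m‖ ≤ C) (hA : 0 < A)
    (hx : ∀ i, ‖x i‖ ≤ A) (n : ℕ) : ∀ i, ‖qc coef J K x n i‖ ≤ A * (C * A) ^ n := by
  induction n using Nat.strong_induction_on with
  | _ n ih =>
  intro i
  cases n with
  | zero => simpa [qc] using hx i
  | succ n =>
    have hn : (0 : ℝ) < (n : ℝ) + 1 := by positivity
    have h1 := congrArg norm (qc_succ coef J K x n i)
    rw [norm_mul] at h1
    have h2 : ‖(n : ℂ) + 1‖ = (n : ℝ) + 1 := by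
      have : ((n : ℂ) + 1) = ((n + 1 : ℕ) : ℂ) := by push_cast; ring
      rw [this, Complex.norm_natCast]; push_cast; ring
    rw [h2] at h1
    have h3 : ‖∑ m, coef i m *
      ∑ p ∈ Finset.range (n + 1), qc coef J K x p (J i m) * qc coef J K x (n - p) (K i m)‖
      ≤ C * ((n + 1) * (A * A * (C * A) ^ n)) := by
      calc _ ≤ ∑ m, ‖coef i m‖ * ((n + 1) * (A * A * (C * A) ^ n)) := by
            refine (norm_sum_le _ _).trans (Finset.sum_le_sum fun m _ => ?_)
            rw [norm_mul]
            gcongr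
            refine (norm_sum_le _ _).trans ?_
            calc _ ≤ ∑ p ∈ Finset.range (n + 1), A * A * (C * A) ^ n := by
                  refine Finset.sum_le_sum fun p hp => ?_
                  rw [Finset.mem_range] at hp
                  rw [norm_mul]
                  have e1 := ih p hp (J i m)
                  have e2 := ih (n - p) (by omega) (K i m)
                  calc _ ≤ (A * (C * A) ^ p) * (A * (C * A) ^ (n - p)) := by
                        gcongr
                    _ = A * A * ((C * A) ^ p * (C * A) ^ (n - p)) := by ring
                    _ = _ := by rw [← pow_add]; congr 2; omega
              _ = _ := by simp
        _ = (∑ m, ‖coef i m‖) * ((n + 1) * (A * A * (C * A) ^ n)) := by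
            rw [Finset.sum_mul]
        _ ≤ _ := by
            gcongr
            exact hcoef i
    rw [← h1] at h3
    have : ((n : ℝ) + 1) * ‖qc coef J K x (n + 1) i‖ ≤ (n + 1) * (A * (C * A) ^ (n + 1)) := by
      refine h3.trans (le_of_eq ?_)
      ring
    exact le_of_mul_le_mul_left this hn

theorem quad_exists {ι : Type} {T : ℕ} (coef : ι → Fin T → ℂ) (J K : ι → Fin T → ι)
    (C A : ℝ) (hC : 0 < C) (hcoef : ∀ i, ∑ m, ‖coef i m‖ ≤ C) (hA : 0 < A)
    (z0 : ℂ) (x : ι → ℂ) (hx : ∀ i, ‖x i‖ ≤ A) :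
    ∃ y : ι → ℂ → ℂ, (∀ i, y i z0 = x i) ∧ ∀ z ∈ ball z0 (1 / (C * A)), ∀ i,
      HasDerivAt (y i) (∑ m, coef i m * (y (J i m) z * y (K i m) z)) z := by
  set c := qc coef J K x with hc
  have hb := qc_bound coef J K x C A hC hcoef hA hx
  rw [← hc] at hb
  set L := C * A with hL
  have hLpos : 0 < L := by positivity
  refine ⟨fun i z => ∑' n, c n i * (z - z0) ^ n, ?_, ?_⟩
  · intro i
    simp only [sub_self]
    rw [tsum_eq_single 0]
    · simp [hc, qc]
    · intro n hn; simp [hn]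
  · intro z hz i
    rw [mem_ball, dist_eq_norm] at hz
    obtain ⟨ρ, hρ1, hρ2⟩ := exists_between hz
    have hρ0 : 0 < ρ := lt_of_le_of_lt (norm_nonneg _) hρ1
    have hLρ : L * ρ < 1 := by
      rw [lt_div_iff₀ hLpos] at hρ2; linarith
    have hLρ0 : 0 < L * ρ := by positivity
    -- norm summability
    have hsn : ∀ w : ℂ, ‖w‖ < ρ → ∀ j, Summable fun n => ‖c n j * w ^ n‖ := by
      intro w hw j
      refine Summable.of_nonneg_of_le (fun _ => norm_nonneg _) (fun n => ?_)
        ((summable_geometric_of_lt_one hLρ0.le hLρ).mul_left A)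
      rw [norm_mul, norm_pow]
      calc _ ≤ (A * L ^ n) * ρ ^ n := by
            gcongr
            exact hb n j
        _ = _ := by rw [mul_pow]; ring
    have hder : HasDerivAt (fun z => ∑' n : ℕ, c n i * (z - z0) ^ n)
        (∑' n, c n i * (n * (z - z0) ^ (n - 1))) z := by
      refine hasDerivAt_tsum_of_isPreconnected (g := fun (n : ℕ) (z : ℂ) => c n i * (z - z0) ^ n)
        (g' := fun (n : ℕ) (z : ℂ) => c n i * (n * (z - z0) ^ (n - 1)))
        (t := ball z0 ρ) (y₀ := z) (u := fun n : ℕ => A / ρ * (n * (L * ρ) ^ n))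
        ?_ isOpen_ball (convex_ball z0 ρ).isPreconnected ?_ ?_ ?_ ?_ ?_
      · refine Summable.mul_left _ ?_
        have := summable_pow_mul_geometric_of_norm_lt_one (R := ℝ) 1 (r := L * ρ) (by
          rw [Real.norm_eq_abs, abs_of_pos hLρ0]; exact hLρ)
        simpa using this
      · intro n w _
        have h1 : HasDerivAt (fun z : ℂ => z - z0) 1 w := (hasDerivAt_id w).sub_const z0
        have := (h1.pow n).const_mul (c n i)
        simpa using this
      · intro n w hw
        rw [mem_ball, dist_eq_norm] at hw
        cases n with
        | zero => simp
        | succ n =>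
          rw [norm_mul, norm_mul, norm_pow, Complex.norm_natCast]
          simp only [Nat.add_sub_cancel]
          calc _ ≤ (A * L ^ (n+1)) * (((n + 1 : ℕ) : ℝ) * ρ ^ n) := by
                gcongr
                exact hb (n+1) i
            _ = _ := by rw [mul_pow L ρ, pow_succ ρ]; field_simp
      · simpa [dist_eq_norm] using hρ1
      · exact (hsn (z - z0) hρ1 i).of_norm
      · simpa [dist_eq_norm] using hρ1
    convert hder using 1
    have hsum' : Summable fun n => c n i * (n * (z - z0) ^ (n - 1)) := by
      refine Summable.of_norm_bounded (g := fun n => A / ρ * (n * (L * ρ) ^ n)) ?_ ?_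
      · refine Summable.mul_left _ ?_
        have := summable_pow_mul_geometric_of_norm_lt_one (R := ℝ) 1 (r := L * ρ) (by
          rw [Real.norm_eq_abs, abs_of_pos hLρ0]; exact hLρ)
        simpa using this
      · intro n
        cases n with
        | zero => simp
        | succ n =>
          rw [norm_mul, norm_mul, norm_pow, Complex.norm_natCast]
          simp only [Nat.add_sub_cancel]
          calc _ ≤ (A * L ^ (n+1)) * (((n + 1 : ℕ) : ℝ) * ρ ^ n) := by
                gcongr
                exact hb (n+1) i
            _ = _ := by rw [mul_pow L ρ, pow_succ ρ]; field_simp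
    rw [hsum'.tsum_eq_zero_add]
    simp only [Nat.cast_zero, zero_mul, mul_zero, zero_add, Nat.add_sub_cancel]
    have hprod : ∀ j k : ι, HasSum (fun n => (∑ p ∈ Finset.range (n + 1), c p j * c (n - p) k) * (z - z0) ^ n)
        ((∑' n, c n j * (z - z0) ^ n) * (∑' n, c n k * (z - z0) ^ n)) := by
      intro j k
      have e1 := hsn (z - z0) hρ1 j
      have e2 := hsn (z - z0) hρ1 k
      have key := tsum_mul_tsum_eq_tsum_sum_range_of_summable_norm e1 e2
      have ks := (summable_norm_sum_mul_range_of_summable_norm e1 e2).of_norm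
      have := ks.hasSum
      rw [← key] at this
      have hfun : (fun n => (∑ p ∈ Finset.range (n + 1), c p j * c (n - p) k) * (z - z0) ^ n) =
          fun n => ∑ p ∈ Finset.range (n + 1), c p j * (z - z0) ^ p * (c (n - p) k * (z - z0) ^ (n - p)) := by
        funext n
        rw [Finset.sum_mul]
        refine Finset.sum_congr rfl fun p hp => ?_
        rw [Finset.mem_range] at hp
        have : (z - z0) ^ n = (z - z0) ^ p * (z - z0) ^ (n - p) := by
          rw [← pow_add]; congr 1; omega
        rw [this]; ring
      rw [hfun]; exact this
    have hS := hasSum_sum (s := Finset.univ) (fun (m : Fin T) _ => (hprod (J i m) (K i m)).mul_left (coef i m))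
    rw [← hS.tsum_eq]
    refine tsum_congr fun n => ?_
    have := qc_succ coef J K x n i
    rw [← hc] at this
    calc _ = (((n : ℂ) + 1) * c (n + 1) i) * (z - z0) ^ n := by
          rw [this, Finset.sum_mul]
          refine Finset.sum_congr rfl fun m _ => ?_
          ring
      _ = _ := by push_cast; ring


theorem lin_unique {E : Type*} [NormedAddCommGroup E] [NormedSpace ℂ E] (e e' : ℂ → E) (B : ℂ → ℝ)
    (z0 : ℂ) (r : ℝ) (hB : ContinuousOn B (ball z0 r))
    (he : ∀ z ∈ ball z0 r, HasDerivAt e (e' z) z)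
    (hb : ∀ z ∈ ball z0 r, ‖e' z‖ ≤ B z * ‖e z‖) (h0 : e z0 = 0) :
    ∀ z ∈ ball z0 r, e z = 0 := by
  intro z hz
  have hseg : ∀ s ∈ Set.Icc (0:ℝ) 1, z0 + (s : ℂ) * (z - z0) ∈ ball z0 r := by
    intro s hs
    rw [mem_ball, dist_eq_norm] at hz ⊢
    rw [add_sub_cancel_left, norm_mul, Complex.norm_real, Real.norm_eq_abs, abs_of_nonneg hs.1]
    calc s * ‖z - z0‖ ≤ 1 * ‖z - z0‖ := by gcongr; exact hs.2
      _ < r := by linarith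
  have hd : ∀ s : ℝ, HasDerivAt (fun s : ℝ => z0 + (s : ℂ) * (z - z0)) (z - z0) s := by
    intro s
    have := ((Complex.ofRealCLM.hasDerivAt (x := s)).mul_const (z - z0)).const_add z0
    simpa using this
  have hcomp : ∀ s ∈ Set.Icc (0:ℝ) 1, HasDerivAt (fun s : ℝ => e (z0 + (s : ℂ) * (z - z0)))
      ((z - z0) • e' (z0 + (s : ℂ) * (z - z0))) s := by
    intro s hs
    exact HasDerivAt.scomp s (he _ (hseg s hs)) (hd s)
  have hBc : ContinuousOn (fun s : ℝ => B (z0 + (s : ℂ) * (z - z0))) (Set.Icc 0 1) :=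
    hB.comp (fun s _ => (hd s).continuousAt.continuousWithinAt) hseg
  obtain ⟨M, hM⟩ := isCompact_Icc.exists_bound_of_continuousOn hBc
  have := eq_zero_of_abs_deriv_le_mul_abs_self_of_eq_zero_right
    (f := fun s : ℝ => e (z0 + (s : ℂ) * (z - z0)))
    (f' := fun s : ℝ => (z - z0) • e' (z0 + (s : ℂ) * (z - z0))) (K := ‖z - z0‖ * M) (a := 0) (b := 1)
    (fun s hs => (hcomp s hs).continuousAt.continuousWithinAt)
    (fun s hs => (hcomp s ⟨hs.1, hs.2.le⟩).hasDerivWithinAt) (by simpa using h0) (by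
      intro s hs
      have hs' : s ∈ Set.Icc (0:ℝ) 1 := ⟨hs.1, hs.2.le⟩
      rw [norm_smul, mul_assoc]
      gcongr
      refine (hb _ (hseg s hs')).trans ?_
      gcongr
      exact (le_abs_self _).trans (hM s hs')) 1 (by simp)
  simpa using this

def IsSol (a : Fin 3 → ℂ) (F : Fin 3 → ℂ → ℂ) (z : ℂ) : Prop :=
  ∀ k, HasDerivAt (F k) (F k z * (F (k + 1) z - F (k + 2) z) + a k) z

def MSol (a : Fin 3 → ℂ) (F : Fin 3 → ℂ → ℂ) (B : Set ℂ) : Prop :=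
  (∀ k, MeromorphicNFOn (F k) B) ∧ ∀ z ∈ B, ∀ᶠ w in 𝓝[≠] z, IsSol a F w

theorem sol_unique (a : Fin 3 → ℂ) (F G : Fin 3 → ℂ → ℂ) (z0 : ℂ) (r : ℝ)
    (hF : ∀ z ∈ ball z0 r, IsSol a F z) (hG : ∀ z ∈ ball z0 r, IsSol a G z)
    (h0 : ∀ k, F k z0 = G k z0) : ∀ z ∈ ball z0 r, ∀ k, F k z = G k z := by
  have key := lin_unique (E := Fin 3 → ℂ) (fun z k => F k z - G k z)
    (fun z k => (F k z * (F (k + 1) z - F (k + 2) z) + a k)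
      - (G k z * (G (k + 1) z - G (k + 2) z) + a k))
    (fun z => ∑ k, (‖F (k + 1) z - F (k + 2) z‖ + 2 * ‖G k z‖)) z0 r ?_ ?_ ?_ ?_
  · intro z hz k
    have := congrFun (key z hz) k
    simpa [sub_eq_zero] using this
  · refine continuousOn_finsetSum _ fun k _ => ?_
    have hFc : ∀ k, ContinuousOn (F k) (ball z0 r) := fun k z hz =>
      (hF z hz k).continuousAt.continuousWithinAt
    have hGc : ∀ k, ContinuousOn (G k) (ball z0 r) := fun k z hz =>
      (hG z hz k).continuousAt.continuousWithinAt
    exact ((hFc _).sub (hFc _)).norm.add (continuousOn_const.mul (hGc k).norm)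
  · intro z hz
    rw [hasDerivAt_pi]
    intro k
    exact (hF z hz k).sub (hG z hz k)
  · intro z hz
    rw [pi_norm_le_iff_of_nonneg (by positivity)]
    intro k
    set e : Fin 3 → ℂ := fun k => F k z - G k z with he
    have h1 : (F k z * (F (k + 1) z - F (k + 2) z) + a k)
      - (G k z * (G (k + 1) z - G (k + 2) z) + a k)
      = (F (k + 1) z - F (k + 2) z) * e k + G k z * (e (k + 1) - e (k + 2)) := by
      simp only [he]; ring
    rw [h1]
    calc _ ≤ ‖F (k + 1) z - F (k + 2) z‖ * ‖e‖ + ‖G k z‖ * (‖e‖ + ‖e‖) := by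
          refine (norm_add_le _ _).trans ?_
          rw [norm_mul, norm_mul]
          gcongr
          · exact norm_le_pi_norm e k
          · refine (norm_sub_le _ _).trans ?_
            gcongr
            · exact norm_le_pi_norm e _
            · exact norm_le_pi_norm e _
      _ = (‖F (k + 1) z - F (k + 2) z‖ + 2 * ‖G k z‖) * ‖e‖ := by ring
      _ ≤ _ := by
          gcongr
          exact Finset.single_le_sum (f := fun k => ‖F (k + 1) z - F (k + 2) z‖ + 2 * ‖G k z‖)
            (fun i _ => by positivity) (Finset.mem_univ k)
  · funext k
    simp [h0 k]

/-- identity principle for normal-form meromorphic functions -/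
theorem nf_identity (f g : ℂ → ℂ) (B : Set ℂ) (hB : IsPreconnected B)
    (hf : MeromorphicNFOn f B) (hg : MeromorphicNFOn g B) (x : ℂ) (hx : x ∈ B)
    (h : ∀ᶠ z in 𝓝[≠] x, f z = g z) : ∀ z ∈ B, f z = g z := by
  intro z hz
  have hm : MeromorphicOn (f - g) B := hf.meromorphicOn.sub hg.meromorphicOn
  have h1 : meromorphicOrderAt (f - g) x = ⊤ := by
    rw [meromorphicOrderAt_eq_top_iff]
    filter_upwards [h] with w hw
    simp [hw]
  have h2 : meromorphicOrderAt (f - g) z = ⊤ := by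
    by_contra hne
    exact hm.meromorphicOrderAt_ne_top_of_isPreconnected hB hz hx hne h1
  rw [meromorphicOrderAt_eq_top_iff] at h2
  have h3 : f =ᶠ[𝓝[≠] z] g := by
    filter_upwards [h2] with w hw
    simpa [sub_eq_zero] using hw
  exact (((hf hz).eventuallyEq_nhdsNE_iff_eventuallyEq_nhds (hg hz)).1 h3).eq_of_nhds

theorem glue {ι : Type*} (a : Fin 3 → ℂ) (B : ι → Set ℂ) (F : ι → Fin 3 → ℂ → ℂ)
    (hB : ∀ i, IsOpen (B i)) (hF : ∀ i, MSol a (F i) (B i))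
    (hc : ∀ i j, ∀ z ∈ B i ∩ B j, ∀ k, F i k z = F j k z) :
    ∃ G : Fin 3 → ℂ → ℂ, MSol a G (⋃ i, B i) ∧ ∀ i, ∀ z ∈ B i, ∀ k, G k z = F i k z := by
  classical
  let G : Fin 3 → ℂ → ℂ := fun k z => if h : ∃ i, z ∈ B i then F h.choose k z else 0
  have hG : ∀ i, ∀ z ∈ B i, ∀ k, G k z = F i k z := by
    intro i z hz k
    have h : ∃ i, z ∈ B i := ⟨i, hz⟩
    simp only [G, dif_pos h]
    exact hc _ _ z ⟨h.choose_spec, hz⟩ k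
  have hev : ∀ i, ∀ z ∈ B i, ∀ k, G k =ᶠ[𝓝 z] F i k := fun i z hz k =>
    Filter.eventually_of_mem ((hB i).mem_nhds hz) fun w hw => hG i w hw k
  refine ⟨G, ⟨?_, ?_⟩, hG⟩
  · intro k z hz
    obtain ⟨i, hi⟩ := Set.mem_iUnion.1 hz
    exact (meromorphicNFAt_congr (hev i z hi k)).2 ((hF i).1 k hi)
  · intro z hz
    obtain ⟨i, hi⟩ := Set.mem_iUnion.1 hz
    have hBi : ∀ᶠ w in 𝓝[≠] z, w ∈ B i :=
      nhdsWithin_le_nhds ((hB i).mem_nhds hi)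
    filter_upwards [(hF i).2 z hi, hBi] with w hw hwB k
    have := (hw k).congr_of_eventuallyEq (hev i w hwB k)
    simpa only [hG i w hwB] using this


theorem isSol_congr {a : Fin 3 → ℂ} {F G : Fin 3 → ℂ → ℂ} {z : ℂ} (hG : IsSol a G z)
    (h : ∀ k, F k =ᶠ[𝓝 z] G k) : IsSol a F z := by
  intro k
  have := (hG k).congr_of_eventuallyEq (h k)
  simpa only [(h _).eq_of_nhds] using this

theorem nf_of_mero (a : Fin 3 → ℂ) (G : Fin 3 → ℂ → ℂ) (B : Set ℂ)
    (hG : ∀ k, MeromorphicOn (G k) B) (hode : ∀ z ∈ B, ∀ᶠ w in 𝓝[≠] z, IsSol a G w)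
    (z1 : ℂ) (hz1 : z1 ∈ B) (h1 : ∀ᶠ w in 𝓝 z1, IsSol a G w) :
    ∃ F, MSol a F B ∧ (∀ k, F k z1 = G k z1) ∧ IsSol a F z1 := by
  refine ⟨fun k => toMeromorphicNFOn (G k) B, ⟨fun k => meromorphicNFOn_toMeromorphicNFOn _ _, ?_⟩, ?_⟩
  · intro z hz
    have h2 : ∀ᶠ w in 𝓝[≠] z, ∀ k, toMeromorphicNFOn (G k) B =ᶠ[𝓝 w] G k := by
      rw [Filter.eventually_all]
      intro k
      have := ((hG k).toMeromorphicNFOn_eq_self_on_nhdsNE hz)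
      have h3 := eventually_eventually_nhdsWithin.2 this
      filter_upwards [h3, self_mem_nhdsWithin] with w hw hwz
      rwa [(isOpen_compl_singleton).nhdsWithin_eq hwz] at hw
    filter_upwards [hode z hz, h2] with w hw1 hw2
    exact isSol_congr hw1 hw2
  · have han : ∀ k, AnalyticAt ℂ (G k) z1 := by
      intro k
      rw [Complex.analyticAt_iff_eventually_differentiableAt]
      filter_upwards [h1] with w hw
      exact (hw k).differentiableAt
    have heq : ∀ k, toMeromorphicNFOn (G k) B =ᶠ[𝓝 z1] G k := by
      intro k
      have e := toMeromorphicNFOn_eq_toMeromorphicNFAt_on_nhds (hG k) hz1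
      rwa [toMeromorphicNFAt_eq_self.2 (han k).meromorphicNFAt] at e
    exact ⟨fun k => (heq k).eq_of_nhds, isSol_congr h1.self_of_nhds heq⟩

theorem const_of_deriv_zero (f : ℂ → ℂ) (z0 : ℂ) (r : ℝ) (c : ℂ) (h0 : f z0 = c)
    (hf : ∀ z ∈ ball z0 r, HasDerivAt f 0 z) : ∀ z ∈ ball z0 r, f z = c := by
  intro z hz
  have := lin_unique (fun z => f z - c) (fun _ => 0) (fun _ => 0) z0 r continuousOn_const
    (fun z hz => (hf z hz).sub_const c) (by simp) (by simp [h0]) z hz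
  simpa [sub_eq_zero] using this

theorem plain_ext (a : Fin 3 → ℂ) (A : ℝ) (hA : 0 < A) : ∃ r > 0, ∀ (z1 : ℂ) (x : Fin 3 → ℂ),
    (∀ k, ‖x k‖ ≤ A) → ∃ F, MSol a F (ball z1 r) ∧ (∀ k, F k z1 = x k) ∧ IsSol a F z1 := by
  set C : ℝ := 2 + ∑ k, ‖a k‖ with hC
  have hCpos : 0 < C := by positivity
  have hr : 0 < 1 / (C * (A + 1)) := by positivity
  refine ⟨1 / (C * (A + 1)), hr, ?_⟩
  intro z1 x hx
  obtain ⟨y, hy0, hy⟩ := quad_exists (ι := Option (Fin 3)) (T := 3)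
    (fun o => match o with | none => 0 | some k => ![1, -1, a k])
    (fun o => match o with | none => fun _ => none | some k => ![some k, some k, none])
    (fun o => match o with | none => fun _ => none | some k => ![some (k + 1), some (k + 2), none])
    C (A + 1) hCpos (by
      rintro (_ | k)
      · simpa using hCpos.le
      · simp only [Fin.sum_univ_three]
        have : ‖a k‖ ≤ ∑ k, ‖a k‖ :=
          Finset.single_le_sum (f := fun k => ‖a k‖) (fun i _ => norm_nonneg _) (Finset.mem_univ k)
        simp
        linarith) (by positivity) z1
    (fun o => match o with | none => 1 | some k => x k) (by
      rintro (_ | k)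
      · simp; linarith
      · have := hx k
        simp; linarith)
  have hone : ∀ z ∈ ball z1 (1 / (C * (A + 1))), y none z = 1 := by
    refine const_of_deriv_zero _ _ _ _ (hy0 none) ?_
    intro z hz
    simpa using hy z hz none
  have hsol : ∀ z ∈ ball z1 (1 / (C * (A + 1))), IsSol a (fun k => y (some k)) z := by
    intro z hz k
    have := hy z hz (some k)
    simp only [Fin.sum_univ_three] at this
    simp [hone z hz] at this
    convert this using 1
    ring
  have hmem : z1 ∈ ball z1 (1 / (C * (A + 1))) := mem_ball_self hr
  refine ⟨fun k => y (some k), ⟨?_, ?_⟩, fun k => hy0 (some k), hsol z1 hmem⟩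
  · intro k
    refine AnalyticOnNhd.meromorphicNFOn ?_
    refine DifferentiableOn.analyticOnNhd ?_ isOpen_ball
    exact fun z hz => (hsol z hz k).differentiableAt.differentiableWithinAt
  · intro z hz
    have : ∀ᶠ w in 𝓝 z, w ∈ ball z1 (1 / (C * (A + 1))) := isOpen_ball.mem_nhds hz
    filter_upwards [nhdsWithin_le_nhds this] with w hw
    exact hsol w hw

theorem fin3_cases (k j : Fin 3) : j = k ∨ j = k + 1 ∨ j = k + 2 := by
  revert k j; decide

theorem fin3_facts (k : Fin 3) : k + 1 ≠ k ∧ k + 2 ≠ k ∧ k + 2 ≠ k + 1 ∧ k + 1 + 1 = k + 2 ∧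
    k + 1 + 2 = k ∧ k + 2 + 1 = k ∧ k + 2 + 2 = k + 1 := by
  revert k; decide

theorem pole_ext (a : Fin 3 → ℂ) (A : ℝ) (hA : 0 < A) : ∃ r > 0, ∀ (z1 : ℂ) (x : Fin 3 → ℂ) (k : Fin 3),
    x (k + 1) ≠ 0 → ‖(x (k + 1))⁻¹‖ ≤ A → ‖x k‖ ≤ A → ‖x k * x (k + 1)‖ ≤ A →
    ‖x (k + 1) * (x k * x (k + 1) + a k)‖ ≤ A → ‖x k + x (k + 1) + x (k + 2)‖ ≤ A →
    ∃ F, MSol a F (ball z1 r) ∧ (∀ k, F k z1 = x k) ∧ IsSol a F z1 := by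
  set N : ℝ := ∑ k, ‖a k‖ with hN
  have hNk : ∀ k, ‖a k‖ ≤ N := fun k =>
    Finset.single_le_sum (f := fun k => ‖a k‖) (fun i _ => norm_nonneg _) (Finset.mem_univ k)
  have hN0 : 0 ≤ N := by positivity
  set C : ℝ := 4 + 3 * N + N * N with hC
  have hCpos : 0 < C := by positivity
  have hr : 0 < 1 / (C * (A + 1)) := by positivity
  refine ⟨1 / (C * (A + 1)), hr, ?_⟩
  intro z1 x k hx0 hu0 hq0 hp0 hv0 ht0
  set a0 := a k with ha0
  set a1 := a (k + 1) with ha1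
  set a2 := a (k + 2) with ha2
  have n0 := hNk k
  have n1 := hNk (k + 1)
  have n2 := hNk (k + 2)
  rw [← ha0] at n0; rw [← ha1] at n1; rw [← ha2] at n2
  obtain ⟨y, hy0, hy⟩ := quad_exists (ι := Fin 6) (T := 5)
    ![![1, -1, 2, -a1, 0], ![1, -2, 2 * a1, a1 * a0, -1], ![1, -1, a1, 0, 0], ![2, 1, -1, a0, 0],
      ![a0 + a1 + a2, 0, 0, 0, 0], ![0, 0, 0, 0, 0]]
    ![![5, 4, 0, 0, 5], ![4, 3, 2, 5, 2], ![1, 3, 3, 5, 5], ![2, 3, 4, 5, 5], ![5, 5, 5, 5, 5],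
      ![5, 5, 5, 5, 5]]
    ![![5, 0, 3, 0, 5], ![1, 1, 5, 5, 2], ![5, 2, 5, 5, 5], ![5, 3, 3, 5, 5], ![5, 5, 5, 5, 5],
      ![5, 5, 5, 5, 5]]
    C (A + 1) hCpos (by
      have h12 : ‖a1‖ * ‖a0‖ ≤ N * N := by gcongr
      have h3 : ‖a0 + a1 + a2‖ ≤ 3 * N := by
        refine (norm_add₃_le).trans ?_
        linarith
      have hNN : 0 ≤ N * N := by positivity
      intro i
      fin_cases i <;> simp [Fin.sum_univ_five] <;> linarith) (by positivity) z1
    ![(x (k + 1))⁻¹, x (k + 1) * (x k * x (k + 1) + a k), x k * x (k + 1), x k,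
      x k + x (k + 1) + x (k + 2), 1] (by
      intro i
      fin_cases i <;> simp only [Fin.isValue, Fin.zero_eta, Fin.mk_one, Fin.reduceFinMk, Matrix.cons_val]
        <;> first | linarith | (rw [norm_one]; linarith))
  have ha := hy0 0
  have hb := hy0 1
  have hc := hy0 2
  have hd := hy0 3
  have he := hy0 4
  simp only [Fin.isValue, Matrix.cons_val] at ha hb hc hd he
  set D := ball z1 (1 / (C * (A + 1))) with hD
  have hmem : z1 ∈ D := mem_ball_self hr
  have hone : ∀ z ∈ D, y 5 z = 1 := by
    refine const_of_deriv_zero _ _ _ _ (by simpa using hy0 5) ?_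
    intro z hz
    simpa [Fin.sum_univ_five] using hy z hz 5
  have hu : ∀ z ∈ D, HasDerivAt (y 0) (1 - y 4 z * y 0 z + 2 * (y 0 z * y 3 z) - a1 * (y 0 z * y 0 z)) z := by
    intro z hz
    have := hy z hz 0
    simp [Fin.sum_univ_five, hone z hz] at this
    convert this using 1; ring
  have hv : ∀ z ∈ D, HasDerivAt (y 1) (y 4 z * y 1 z - 2 * (y 3 z * y 1 z) + 2 * a1 * y 2 z + a1 * a0 - y 2 z * y 2 z) z := by
    intro z hz
    have := hy z hz 1
    simp [Fin.sum_univ_five, hone z hz] at this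
    convert this using 1; ring
  have hp : ∀ z ∈ D, HasDerivAt (y 2) (y 1 z - y 3 z * y 2 z + a1 * y 3 z) z := by
    intro z hz
    have := hy z hz 2
    simp [Fin.sum_univ_five, hone z hz] at this
    convert this using 1; ring
  have hq : ∀ z ∈ D, HasDerivAt (y 3) (2 * y 2 z + y 3 z * y 3 z - y 4 z * y 3 z + a0) z := by
    intro z hz
    have := hy z hz 3
    simp [Fin.sum_univ_five, hone z hz] at this
    convert this using 1; ring
  have ht : ∀ z ∈ D, HasDerivAt (y 4) (a0 + a1 + a2) z := by
    intro z hz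
    have := hy z hz 4
    simp [Fin.sum_univ_five, hone z hz] at this
    convert this using 1
  have hcons : ∀ z ∈ D, (fun z => ((y 2 z - y 0 z * y 1 z + a0, y 3 z - y 0 z * y 2 z) : ℂ × ℂ)) z = 0 := by
    have c0 : ContinuousOn (y 0) D := fun z hz => (hu z hz).continuousAt.continuousWithinAt
    have c2 : ContinuousOn (y 2) D := fun z hz => (hp z hz).continuousAt.continuousWithinAt
    have c3 : ContinuousOn (y 3) D := fun z hz => (hq z hz).continuousAt.continuousWithinAt
    have c4 : ContinuousOn (y 4) D := fun z hz => (ht z hz).continuousAt.continuousWithinAt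
    refine lin_unique _ (fun z => (((a1 - y 2 z) * (y 3 z - y 0 z * y 2 z) - a1 * y 0 z * (y 2 z - y 0 z * y 1 z + a0),
        (y 2 z - y 0 z * y 1 z + a0) + (y 3 z - y 4 z - a1 * y 0 z) * (y 3 z - y 0 z * y 2 z)) : ℂ × ℂ))
      (fun z => ‖a1 - y 2 z‖ + ‖a1 * y 0 z‖ + 1 + ‖y 3 z - y 4 z - a1 * y 0 z‖) z1 _ ?_ ?_ ?_ ?_
    · have : ContinuousOn (fun z => a1 * y 0 z) D := continuousOn_const.mul c0
      exact (((continuousOn_const.sub c2).norm.add this.norm).add continuousOn_const).add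
        ((c3.sub c4).sub this).norm
    · intro z hz
      refine HasDerivAt.prodMk ?_ ?_
      · exact HasDerivAt.congr_deriv (((hp z hz).sub ((hu z hz).mul (hv z hz))).add_const a0) (by ring)
      · exact HasDerivAt.congr_deriv ((hq z hz).sub ((hu z hz).mul (hp z hz))) (by ring)
    · intro z hz
      set e1 := y 2 z - y 0 z * y 1 z + a0 with he1
      set e2 := y 3 z - y 0 z * y 2 z with he2
      have m1 : ‖e1‖ ≤ ‖((e1, e2) : ℂ × ℂ)‖ := norm_fst_le (e1, e2)
      have m2 : ‖e2‖ ≤ ‖((e1, e2) : ℂ × ℂ)‖ := norm_snd_le (e1, e2)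
      set m := ‖((e1, e2) : ℂ × ℂ)‖ with hm
      have hm0 : 0 ≤ m := norm_nonneg _
      rw [Prod.norm_def]
      refine max_le ?_ ?_
      · calc _ ≤ ‖a1 - y 2 z‖ * m + ‖a1 * y 0 z‖ * m := by
              refine (norm_sub_le _ _).trans ?_
              rw [norm_mul, norm_mul (a1 * y 0 z)]
              gcongr
          _ ≤ _ := by
              have := norm_nonneg (y 3 z - y 4 z - a1 * y 0 z)
              nlinarith
      · calc _ ≤ m + ‖y 3 z - y 4 z - a1 * y 0 z‖ * m := by
              refine (norm_add_le _ _).trans ?_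
              rw [norm_mul]
              gcongr
          _ ≤ _ := by
              have := norm_nonneg (a1 - y 2 z)
              have := norm_nonneg (a1 * y 0 z)
              nlinarith
    · have : (x (k + 1))⁻¹ * (x (k + 1) * (x k * x (k + 1) + a k)) = x k * x (k + 1) + a k := by
        rw [← mul_assoc, inv_mul_cancel₀ hx0, one_mul]
      simp only [ha, hb, hc, hd, this]
      simp only [Prod.mk_eq_zero]
      constructor
      · ring
      · field_simp; ring
  have hcons2 : ∀ z ∈ D, y 3 z = y 0 z * y 2 z := by
    intro z hz
    have := (Prod.mk_eq_zero.1 (hcons z hz)).2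
    linear_combination this
  obtain ⟨f1, f2, f3, f4, f5, f6, f7⟩ := fin3_facts k
  let G : Fin 3 → ℂ → ℂ := fun j => if j = k then y 3 else if j = k + 1 then fun z => (y 0 z)⁻¹
    else fun z => y 4 z - y 3 z - (y 0 z)⁻¹
  have G0 : G k = y 3 := by simp [G]
  have G1 : G (k + 1) = fun z => (y 0 z)⁻¹ := by simp [G]
  have G2 : G (k + 2) = fun z => y 4 z - y 3 z - (y 0 z)⁻¹ := by simp [G, f2, f3]
  have hsol : ∀ z ∈ D, y 0 z ≠ 0 → IsSol a G z := by
    intro z hz hne j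
    have hinv := (hu z hz).inv hne
    have hpq : y 2 z = y 3 z / y 0 z := by rw [hcons2 z hz]; field_simp
    rcases fin3_cases k j with rfl | rfl | rfl
    · rw [G0, G1, G2]
      convert hq z hz using 1
      rw [hpq]; field_simp; ring
    · rw [f4, f5, G0, G1, G2]
      refine HasDerivAt.congr_deriv hinv ?_
      field_simp; ring
    · rw [f6, f7, G0, G1, G2]
      refine HasDerivAt.congr_deriv (((ht z hz).sub (hq z hz)).sub hinv) ?_
      rw [hpq]; field_simp; ring
  have hiso : ∀ z ∈ D, ∀ᶠ w in 𝓝[≠] z, y 0 w ≠ 0 := by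
    intro z hz
    by_cases h : y 0 z = 0
    · have := (hu z hz).eventually_ne (c := 0) (by simp [h])
      exact this
    · exact nhdsWithin_le_nhds ((hu z hz).continuousAt.eventually_ne h)
  have hDopen : IsOpen D := isOpen_ball
  have hy1 : y 0 z1 ≠ 0 := by rw [ha]; exact inv_ne_zero hx0
  have s1 : ∀ k, MeromorphicOn (G k) D := by
    have an : ∀ i : Fin 6, MeromorphicOn (y i) D := by
      intro i
      refine AnalyticOnNhd.meromorphicOn (DifferentiableOn.analyticOnNhd ?_ hDopen)
      exact fun z hz => (hy z hz i).differentiableAt.differentiableWithinAt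
    intro j
    rcases fin3_cases k j with rfl | rfl | rfl
    · rw [G0]; exact an 3
    · rw [G1]; exact (an 0).inv
    · rw [G2]; exact ((an 4).sub (an 3)).sub (an 0).inv
  have s2 : ∀ z ∈ D, ∀ᶠ w in 𝓝[≠] z, IsSol a G w := by
    intro z hz
    filter_upwards [hiso z hz, nhdsWithin_le_nhds (hDopen.mem_nhds hz)] with w hw hwD
    exact hsol w hwD hw
  have s3 : ∀ᶠ w in 𝓝 z1, IsSol a G w := by
    filter_upwards [hDopen.mem_nhds hmem, (hu z1 hmem).continuousAt.eventually_ne hy1] with w hwD hw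
    exact hsol w hwD hw
  obtain ⟨F, hF1, hF2, hF3⟩ := nf_of_mero a G D s1 s2 z1 hmem s3
  refine ⟨F, hF1, ?_, hF3⟩
  intro j
  rw [hF2]
  rcases fin3_cases k j with rfl | rfl | rfl
  · rw [G0, hd]
  · simp only [G1, ha, inv_inv]
  · simp only [G2, ha, hd, he, inv_inv]; ring


theorem exists_cutoff : ∃ (φ : ℂ → ℝ) (D : ℝ), 0 ≤ D ∧ (∀ x, DifferentiableAt ℝ φ x) ∧ (∀ x, |φ x| ≤ 1) ∧
    (∀ x, ‖x‖ < 1 → φ x = 1) ∧ (∀ x, 2 < ‖x‖ → φ x = 0) ∧ (∀ x, ‖fderiv ℝ φ x‖ ≤ D) ∧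
    (∀ x, 2 < ‖x‖ → fderiv ℝ φ x = 0) := by
  let b : ContDiffBump (0 : ℂ) := ⟨1, 2, by norm_num, by norm_num⟩
  have hb : ContDiff ℝ 1 (b : ℂ → ℝ) := b.contDiff
  have hc : Continuous (fderiv ℝ (b : ℂ → ℝ)) := hb.continuous_fderiv (by norm_num)
  have hs : HasCompactSupport (fderiv ℝ (b : ℂ → ℝ)) := b.hasCompactSupport.fderiv (𝕜 := ℝ)
  obtain ⟨D, hD⟩ := hs.exists_bound_of_continuous hc
  have h0 : ∀ x : ℂ, 2 < ‖x‖ → b x = 0 := by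
    intro x hx
    apply b.zero_of_le_dist
    rw [dist_zero_right]; exact hx.le
  refine ⟨b, D, (norm_nonneg _).trans (hD 0), fun x => hb.differentiable (by norm_num) x, ?_, ?_, h0, hD, ?_⟩
  · intro x
    rw [abs_of_nonneg b.nonneg]
    exact b.le_one
  · intro x hx
    apply b.one_of_mem_closedBall
    rw [mem_closedBall, dist_zero_right]
    exact hx.le
  · intro x hx
    have : (b : ℂ → ℝ) =ᶠ[𝓝 x] fun _ => 0 := by
      filter_upwards [(isOpen_lt continuous_const continuous_norm).mem_nhds hx] with w hw
      exact h0 w hw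
    rw [this.fderiv_eq]
    simp

noncomputable def Wc (φ : ℂ → ℝ) (a0 a1 a2 x y z : ℂ) : ℂ :=
  x * y * z + ((a1 - a2) * x + (a2 - a0) * y + (a0 - a1) * z) / 3
    - (a0 + a1 + a2) / 6 * (φ x * (y - z) + φ y * (z - x) + φ z * (x - y))

theorem Wc_cyc (φ : ℂ → ℝ) (a0 a1 a2 x y z : ℂ) : Wc φ a1 a2 a0 y z x = Wc φ a0 a1 a2 x y z := by
  unfold Wc; ring

theorem lin3 (p q r x y z : ℂ) (B N : ℝ) (hp : ‖p‖ ≤ B) (hq : ‖q‖ ≤ B) (hr : ‖r‖ ≤ B)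
    (hN : ‖x‖ + ‖y‖ + ‖z‖ = N) : ‖p * x + q * y + r * z‖ ≤ B * N := by
  have h1 : ‖p‖ * ‖x‖ ≤ B * ‖x‖ := by gcongr
  have h2 : ‖q‖ * ‖y‖ ≤ B * ‖y‖ := by gcongr
  have h3 : ‖r‖ * ‖z‖ ≤ B * ‖z‖ := by gcongr
  calc _ ≤ ‖p * x‖ + ‖q * y‖ + ‖r * z‖ := norm_add₃_le
    _ = ‖p‖ * ‖x‖ + ‖q‖ * ‖y‖ + ‖r‖ * ‖z‖ := by simp only [norm_mul]
    _ ≤ B * N := by rw [← hN]; linarith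

theorem Wc_lower (φ : ℂ → ℝ) (hφ : ∀ x, |φ x| ≤ 1) (a0 a1 a2 x y z : ℂ) (A T N : ℝ)
    (h0 : ‖a0‖ ≤ A) (h1 : ‖a1‖ ≤ A) (h2 : ‖a2‖ ≤ A) (ht : ‖x + y + z‖ ≤ T)
    (hN : ‖x‖ + ‖y‖ + ‖z‖ = N) (hx : 1 ≤ ‖x‖) (hy : 1 ≤ ‖y‖) (hz : 1 ≤ ‖z‖)
    (hR : 2 * T + 4 ≤ N) (hR2 : 48 * A ≤ N) : N ^ 2 / 24 ≤ ‖Wc φ a0 a1 a2 x y z‖ := by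
  have hsub : ∀ p q : ℂ, ‖p‖ ≤ A → ‖q‖ ≤ A → ‖p - q‖ ≤ 2 * A := fun p q hp hq =>
    (norm_sub_le _ _).trans (by linarith)
  have tri : ∀ u v w : ℂ, ‖u + v + w‖ ≤ T → ‖u‖ ≤ ‖v‖ + ‖w‖ + T := by
    intro u v w h
    have : u = (u + v + w) - v - w := by ring
    calc ‖u‖ = ‖(u + v + w) - v - w‖ := by rw [← this]
      _ ≤ ‖u + v + w‖ + ‖v‖ + ‖w‖ := (norm_sub_le _ _).trans (by gcongr; exact norm_sub_le _ _)
      _ ≤ _ := by linarith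
  have t1 := tri x y z ht
  have t2 := tri y z x (by rwa [show y + z + x = x + y + z by ring])
  have t3 := tri z x y (by rwa [show z + x + y = x + y + z by ring])
  have hA : 0 ≤ A := (norm_nonneg _).trans h0
  have hprod : N ^ 2 / 12 ≤ ‖x * y * z‖ := by
    rw [norm_mul, norm_mul]
    set X := ‖x‖; set Y := ‖y‖; set Z := ‖z‖
    have e1 : N / 4 ≤ Y * Z := by nlinarith
    have e2 : N / 4 ≤ Z * X := by nlinarith
    have e3 : N / 4 ≤ X * Y := by nlinarith
    nlinarith [mul_le_mul_of_nonneg_left e1 (by linarith : 0 ≤ X), mul_le_mul_of_nonneg_left e2 (by linarith : 0 ≤ Y),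
      mul_le_mul_of_nonneg_left e3 (by linarith : 0 ≤ Z)]
  have hl1 : ‖((a1 - a2) * x + (a2 - a0) * y + (a0 - a1) * z) / 3‖ ≤ A * N := by
    have := lin3 (a1 - a2) (a2 - a0) (a0 - a1) x y z (2 * A) N (hsub _ _ h1 h2) (hsub _ _ h2 h0) (hsub _ _ h0 h1) hN
    have hAN : 0 ≤ A * N := by
      have : 0 ≤ N := by linarith
      positivity
    rw [norm_div]
    simp
    rw [div_le_iff₀ (by norm_num)]
    nlinarith
  have hφn : ∀ x, ‖(φ x : ℂ)‖ ≤ 1 := by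
    intro x; rw [Complex.norm_real]; exact hφ x
  have hl2 : ‖(a0 + a1 + a2) / 6 * (φ x * (y - z) + φ y * (z - x) + φ z * (x - y))‖ ≤ A * N := by
    have e1 : ‖(a0 + a1 + a2) / 6‖ ≤ A / 2 := by
      rw [norm_div]
      have : ‖a0 + a1 + a2‖ ≤ 3 * A := norm_add₃_le.trans (by linarith)
      simp
      linarith
    have e2 : ‖φ x * (y - z) + φ y * (z - x) + φ z * (x - y)‖ ≤ 2 * N := by
      have := lin3 (φ x) (φ y) (φ z) (y - z) (z - x) (x - y) 1 _ (hφn x) (hφn y) (hφn z) rfl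
      have q1 := norm_sub_le y z
      have q2 := norm_sub_le z x
      have q3 := norm_sub_le x y
      linarith
    rw [norm_mul]
    calc _ ≤ A / 2 * (2 * N) := by gcongr
      _ = _ := by ring
  have hW : ‖x * y * z‖ ≤ ‖Wc φ a0 a1 a2 x y z‖ + A * N + A * N := by
    have : x * y * z = Wc φ a0 a1 a2 x y z - ((a1 - a2) * x + (a2 - a0) * y + (a0 - a1) * z) / 3
      + (a0 + a1 + a2) / 6 * (φ x * (y - z) + φ y * (z - x) + φ z * (x - y)) := by unfold Wc; ring
    rw [this]
    refine (norm_add_le _ _).trans ?_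
    gcongr
    refine (norm_sub_le _ _).trans ?_
    gcongr
  nlinarith

theorem third_large (x y z : ℂ) (T N L : ℝ) (ht : ‖x + y + z‖ ≤ T)
    (hN : ‖x‖ + ‖y‖ + ‖z‖ = N) (hx : ‖x‖ < 1) (hL : 2 * L + T + 2 < N) : L < ‖y‖ ∧ L < ‖z‖ := by
  have tri : ∀ u v w : ℂ, ‖u + v + w‖ ≤ T → ‖u‖ ≤ ‖v‖ + ‖w‖ + T := by
    intro u v w h
    have : u = (u + v + w) - v - w := by ring
    calc ‖u‖ = ‖(u + v + w) - v - w‖ := by rw [← this]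
      _ ≤ ‖u + v + w‖ + ‖v‖ + ‖w‖ := (norm_sub_le _ _).trans (by gcongr; exact norm_sub_le _ _)
      _ ≤ _ := by linarith
  have t2 := tri y z x (by rwa [show y + z + x = x + y + z by ring])
  have t3 := tri z x y (by rwa [show z + x + y = x + y + z by ring])
  constructor <;> linarith

/-- pole chart bounds -/
theorem third_chart (φ : ℂ → ℝ) (hφ1 : ∀ x, ‖x‖ < 1 → φ x = 1) (hφ2 : ∀ x, 2 < ‖x‖ → φ x = 0)
    (a0 a1 a2 x y z : ℂ) (A T M : ℝ)
    (h0 : ‖a0‖ ≤ A) (h1 : ‖a1‖ ≤ A) (h2 : ‖a2‖ ≤ A) (ht : ‖x + y + z‖ ≤ T)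
    (hx : ‖x‖ < 1) (hy : 2 * (T + 1) < ‖y‖) (hy2 : 2 < ‖y‖) (hz2 : 2 < ‖z‖)
    (hM : ‖Wc φ a0 a1 a2 x y z‖ ≤ M) :
    ‖y * (x * y + a0)‖ ≤ 2 * (M + 5 * A * (T + 2)) ∧ ‖x * y‖ ≤ 2 * (M + 5 * A * (T + 2)) + A := by
  have hA : 0 ≤ A := (norm_nonneg _).trans h0
  have hT : 0 ≤ T := (norm_nonneg _).trans ht
  have hy0 : y ≠ 0 := by rw [← norm_pos_iff]; linarith
  set v := y * (x * y + a0) with hv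
  set t := x + y + z with htd
  have hp : x * y = v / y - a0 := by rw [hv]; field_simp; ring
  have htx : ‖t - x‖ ≤ T + 1 := (norm_sub_le _ _).trans (by linarith)
  have hW : v = -Wc φ a0 a1 a2 x y z + v / y * (t - x) - a0 * (t - x) + ((a1 - a2) * x + (a0 - a1) * (t - x)) / 3
      - (a0 + a1 + a2) / 6 * (x - t) := by
    unfold Wc
    rw [hφ1 x hx, hφ2 y hy2, hφ2 z hz2]
    have hz : z = t - x - y := by rw [htd]; ring
    rw [hz]
    have : v / y * (t - x) = (x * y + a0) * (t - x) := by rw [hp]; ring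
    rw [this, hv]
    push_cast
    ring
  have hvy : ‖v / y‖ ≤ ‖v‖ / (2 * (T + 1)) := by
    rw [norm_div]; gcongr
  have b1 : ‖v / y * (t - x)‖ ≤ ‖v‖ / 2 := by
    rw [norm_mul]
    calc _ ≤ ‖v‖ / (2 * (T + 1)) * (T + 1) := by gcongr
      _ = _ := by field_simp
  have b2 : ‖a0 * (t - x)‖ ≤ A * (T + 1) := by rw [norm_mul]; gcongr
  have hsub : ∀ p q : ℂ, ‖p‖ ≤ A → ‖q‖ ≤ A → ‖p - q‖ ≤ 2 * A := fun p q hp hq =>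
    (norm_sub_le _ _).trans (by linarith)
  have b3 : ‖((a1 - a2) * x + (a0 - a1) * (t - x)) / 3‖ ≤ 2 * A * (T + 2) := by
    have : ‖(a1 - a2) * x + (a0 - a1) * (t - x)‖ ≤ 2 * A * 1 + 2 * A * (T + 1) := by
      refine (norm_add_le _ _).trans ?_
      rw [norm_mul, norm_mul]
      gcongr
      · exact hsub _ _ h1 h2
      · exact hsub _ _ h0 h1
    rw [norm_div]
    simp
    nlinarith [mul_nonneg hA hT]
  have b4 : ‖(a0 + a1 + a2) / 6 * (x - t)‖ ≤ A * (T + 1) := by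
    rw [norm_mul, norm_sub_rev x t]
    gcongr
    rw [norm_div]
    have : ‖a0 + a1 + a2‖ ≤ 3 * A := norm_add₃_le.trans (by linarith)
    simp
    linarith
  have hvb : ‖v‖ ≤ M + ‖v‖ / 2 + A * (T + 1) + 2 * A * (T + 2) + A * (T + 1) := by
    conv_lhs => rw [hW]
    refine (norm_sub_le _ _).trans (add_le_add ?_ b4)
    refine (norm_add_le _ _).trans (add_le_add ?_ b3)
    refine (norm_sub_le _ _).trans (add_le_add ?_ b2)
    refine (norm_add_le _ _).trans (add_le_add ?_ b1)
    rwa [norm_neg]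
  have hvf : ‖v‖ ≤ 2 * (M + 5 * A * (T + 2)) := by nlinarith [mul_nonneg hA hT]
  refine ⟨hvf, ?_⟩
  rw [hp]
  refine (norm_sub_le _ _).trans (add_le_add ?_ h0)
  rw [norm_div]
  refine (div_le_self (norm_nonneg _) (by linarith)).trans hvf


theorem third_deriv (φ : ℂ → ℝ) (hφ1 : ∀ x, ‖x‖ < 1 → φ x = 1) (hφ2 : ∀ x, 2 < ‖x‖ → φ x = 0)
    (a0 a1 a2 h : ℂ) (x y z : ℝ → ℂ) (u : ℝ) (A T : ℝ)
    (h0 : ‖a0‖ ≤ A) (h1 : ‖a1‖ ≤ A) (h2 : ‖a2‖ ≤ A) (ht : ‖x u + y u + z u‖ ≤ T)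
    (hx : HasDerivAt x (h * (x u * (y u - z u) + a0)) u)
    (hy : HasDerivAt y (h * (y u * (z u - x u) + a1)) u)
    (hz : HasDerivAt z (h * (z u * (x u - y u) + a2)) u)
    (hxs : ‖x u‖ < 1) (hy2 : 2 < ‖y u‖) (hz2 : 2 < ‖z u‖) :
    ∃ d, HasDerivAt (fun u => Wc φ a0 a1 a2 (x u) (y u) (z u)) d u ∧
      ‖d‖ ≤ (2 * A * (T + 1) + 3 * A * A) * ‖h‖ := by
  have hA : 0 ≤ A := (norm_nonneg _).trans h0
  have hT : 0 ≤ T := (norm_nonneg _).trans ht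
  have heq : (fun u => Wc φ a0 a1 a2 (x u) (y u) (z u)) =ᶠ[𝓝 u]
      (fun u => x u * y u * z u + ((a1 - a2) * x u + (a2 - a0) * y u + (a0 - a1) * z u) / 3
        - (a0 + a1 + a2) / 6 * (y u - z u)) := by
    have e1 := hx.continuousAt.norm.eventually_lt continuousAt_const hxs
    have e2 := continuousAt_const.eventually_lt hy.continuousAt.norm hy2
    have e3 := continuousAt_const.eventually_lt hz.continuousAt.norm hz2
    filter_upwards [e1, e2, e3] with w w1 w2 w3
    unfold Wc
    rw [hφ1 _ w1, hφ2 _ w2, hφ2 _ w3]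
    push_cast
    ring
  have hd := (((hx.mul hy).mul hz).add ((((hx.const_mul (a1 - a2)).add (hy.const_mul (a2 - a0))).add
    (hz.const_mul (a0 - a1))).div_const 3)).sub ((hy.sub hz).const_mul ((a0 + a1 + a2) / 6))
  refine ⟨(((a0 + a1 + a2) / 2 * (x u * ((x u + y u + z u) - x u))) + ((a1 - a2) * a0 + (a2 - a0) * a1 + (a0 - a1) * a2) / 3
      - (a0 + a1 + a2) / 6 * (a1 - a2)) * h, (HasDerivAt.congr_deriv hd ?_).congr_of_eventuallyEq heq, ?_⟩
  · simp only [Pi.mul_apply]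
    ring
  · rw [norm_mul]
    gcongr
    have hs : ‖a0 + a1 + a2‖ ≤ 3 * A := norm_add₃_le.trans (by linarith)
    have hsub : ‖a1 - a2‖ ≤ 2 * A := (norm_sub_le _ _).trans (by linarith)
    have q1 : ‖(a0 + a1 + a2) / 2 * (x u * ((x u + y u + z u) - x u))‖ ≤ 3 * A / 2 * (1 * (T + 1)) := by
      rw [norm_mul, norm_mul, norm_div]
      gcongr
      · simp
      · exact (norm_sub_le _ _).trans (by linarith)
    have q2 : (a1 - a2) * a0 + (a2 - a0) * a1 + (a0 - a1) * a2 = 0 := by ring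
    have q3 : ‖(a0 + a1 + a2) / 6 * (a1 - a2)‖ ≤ 3 * A / 6 * (2 * A) := by
      rw [norm_mul, norm_div]
      gcongr
      simp
    rw [q2]
    refine (norm_sub_le _ _).trans ?_
    simp only [zero_div, add_zero]
    nlinarith [mul_nonneg hA hT, mul_nonneg hA hA]

theorem crude_deriv (φ : ℂ → ℝ) (D : ℝ) (hD : 0 ≤ D) (hd : ∀ x, DifferentiableAt ℝ φ x) (hφ : ∀ x, |φ x| ≤ 1)
    (hφD : ∀ x, ‖fderiv ℝ φ x‖ ≤ D) (hφ0 : ∀ x, 2 < ‖x‖ → fderiv ℝ φ x = 0)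
    (A : ℝ) (hA : 0 ≤ A) : ∃ K ≥ 0, ∀ (a0 a1 a2 h : ℂ) (x y z : ℝ → ℂ) (u : ℝ) (N : ℝ),
    ‖a0‖ ≤ A → ‖a1‖ ≤ A → ‖a2‖ ≤ A → 
    HasDerivAt x (h * (x u * (y u - z u) + a0)) u →
    HasDerivAt y (h * (y u * (z u - x u) + a1)) u →
    HasDerivAt z (h * (z u * (x u - y u) + a2)) u →
    ‖x u‖ + ‖y u‖ + ‖z u‖ = N →
    ∃ d, HasDerivAt (fun u => Wc φ a0 a1 a2 (x u) (y u) (z u)) d u ∧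
      ‖d‖ ≤ K * (1 + N) ^ 2 * ‖h‖ := by
  refine ⟨A * 3 + 2 * A * (1 + A) + A / 2 * (6 * (D * (4 + A)) + 6 * (1 + A)), by positivity, ?_⟩
  intro a0 a1 a2 h x y z u N h0 h1 h2 hx hy hz hN
  have nx := norm_nonneg (x u)
  have ny := norm_nonneg (y u)
  have nz := norm_nonneg (z u)
  have hN0 : 0 ≤ N := by linarith
  have dφ : ∀ (w v : ℝ → ℂ) (b : ℂ), ‖b‖ ≤ A → ‖w u‖ ≤ N → ‖v u‖ ≤ 2 * N → HasDerivAt w (h * (w u * v u + b)) u →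
      ∃ ψ : ℝ, HasDerivAt (fun u => (φ (w u) : ℂ)) (ψ : ℂ) u ∧ ‖(ψ : ℂ)‖ ≤ D * (4 + A) * (1 + N) * ‖h‖ := by
    intro w v b hb hw hv hwd
    refine ⟨fderiv ℝ φ (w u) (h * (w u * v u + b)), ?_, ?_⟩
    · have := (hd (w u)).hasFDerivAt.comp_hasDerivAt u hwd
      exact this.ofReal_comp
    · rw [Complex.norm_real]
      by_cases h2 : 2 < ‖w u‖
      · rw [hφ0 _ h2]
        simp
        positivity
      · push Not at h2
        calc _ ≤ ‖fderiv ℝ φ (w u)‖ * ‖h * (w u * v u + b)‖ := ContinuousLinearMap.le_opNorm _ _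
          _ ≤ D * (‖h‖ * (2 * (2 * N) + A)) := by
            rw [norm_mul]
            gcongr
            · exact hφD _
            · refine (norm_add_le _ _).trans ?_
              rw [norm_mul]
              gcongr
          _ ≤ D * (‖h‖ * ((4 + A) * (1 + N))) := by gcongr; nlinarith
          _ = _ := by ring
  have s1 : ‖y u - z u‖ ≤ 2 * N := (norm_sub_le _ _).trans (by linarith)
  have s2 : ‖z u - x u‖ ≤ 2 * N := (norm_sub_le _ _).trans (by linarith)
  have s3 : ‖x u - y u‖ ≤ 2 * N := (norm_sub_le _ _).trans (by linarith)
  have s1' : ‖y u - z u‖ ≤ N := (norm_sub_le _ _).trans (by linarith)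
  have s2' : ‖z u - x u‖ ≤ N := (norm_sub_le _ _).trans (by linarith)
  have s3' : ‖x u - y u‖ ≤ N := (norm_sub_le _ _).trans (by linarith)
  obtain ⟨p1, hp1, bp1⟩ := dφ x (fun u => y u - z u) a0 h0 (by linarith) s1 hx
  obtain ⟨p2, hp2, bp2⟩ := dφ y (fun u => z u - x u) a1 h1 (by linarith) s2 hy
  obtain ⟨p3, hp3, bp3⟩ := dφ z (fun u => x u - y u) a2 h2 (by linarith) s3 hz
  have hd := (((hx.mul hy).mul hz).add ((((hx.const_mul (a1 - a2)).add (hy.const_mul (a2 - a0))).add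
    (hz.const_mul (a0 - a1))).div_const 3)).sub
      ((((hp1.mul (hy.sub hz)).add (hp2.mul (hz.sub hx))).add (hp3.mul (hx.sub hy))).const_mul ((a0 + a1 + a2) / 6))
  set X := x u
  set Y := y u
  set Z := z u
  set V1 := X * (Y - Z) + a0 with hV1
  set V2 := Y * (Z - X) + a1 with hV2
  set V3 := Z * (X - Y) + a2 with hV3
  set Q := (1 + N) ^ 2 with hQ
  have hQN2 : N * N ≤ Q := by nlinarith
  have hQN : N ≤ Q := by nlinarith
  have hQ1 : 1 ≤ Q := by nlinarith
  have bV : ∀ (p q b : ℂ), ‖p‖ ≤ N → ‖q‖ ≤ N → ‖b‖ ≤ A → ‖p * q + b‖ ≤ (1 + A) * Q := by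
    intro p q b hp hq hb
    calc _ ≤ ‖p‖ * ‖q‖ + ‖b‖ := (norm_add_le _ _).trans (by rw [norm_mul])
      _ ≤ N * N + A := by gcongr
      _ ≤ _ := by nlinarith
  have bV1 : ‖V1‖ ≤ (1 + A) * Q := bV _ _ _ (by linarith) s1' h0
  have bV2 : ‖V2‖ ≤ (1 + A) * Q := bV _ _ _ (by linarith) s2' h1
  have bV3 : ‖V3‖ ≤ (1 + A) * Q := bV _ _ _ (by linarith) s3' h2
  have hsub : ∀ p q : ℂ, ‖p‖ ≤ A → ‖q‖ ≤ A → ‖p - q‖ ≤ 2 * A := fun p q hp hq =>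
    (norm_sub_le _ _).trans (by linarith)
  have hφn : ∀ x, ‖(φ x : ℂ)‖ ≤ 1 := by
    intro x; rw [Complex.norm_real]; exact hφ x
  have hs : ‖(a0 + a1 + a2) / 6‖ ≤ A / 2 := by
    rw [norm_div]
    have : ‖a0 + a1 + a2‖ ≤ 3 * A := norm_add₃_le.trans (by linarith)
    simp
    linarith
  refine ⟨h * (a0 * (Y * Z) + a1 * (Z * X) + a2 * (X * Y)) + h * ((a1 - a2) / 3 * V1 + (a2 - a0) / 3 * V2 + (a0 - a1) / 3 * V3)
      - (a0 + a1 + a2) / 6 * ((p1 * (Y - Z) + p2 * (Z - X) + p3 * (X - Y)) +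
        h * (φ X * (V2 - V3) + φ Y * (V3 - V1) + φ Z * (V1 - V2))), HasDerivAt.congr_deriv hd ?_, ?_⟩
  · simp only [Pi.mul_apply, Pi.sub_apply]
    simp only [hV1, hV2, hV3]
    ring
  · have c1 : ‖h * (a0 * (Y * Z) + a1 * (Z * X) + a2 * (X * Y))‖ ≤ ‖h‖ * (A * (3 * Q)) := by
      rw [norm_mul]
      gcongr
      refine (lin3 _ _ _ _ _ _ A _ h0 h1 h2 rfl).trans ?_
      gcongr
      rw [norm_mul, norm_mul, norm_mul]
      have q1 : ‖Y‖ * ‖Z‖ ≤ N * N := by gcongr <;> linarith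
      have q2 : ‖Z‖ * ‖X‖ ≤ N * N := by gcongr <;> linarith
      have q3 : ‖X‖ * ‖Y‖ ≤ N * N := by gcongr <;> linarith
      linarith
    have d3 : ∀ p q : ℂ, ‖p‖ ≤ A → ‖q‖ ≤ A → ‖(p - q) / 3‖ ≤ 2 * A / 3 := by
      intro p q hp hq
      rw [norm_div]
      have := hsub p q hp hq
      simp
      linarith
    have c2 : ‖h * ((a1 - a2) / 3 * V1 + (a2 - a0) / 3 * V2 + (a0 - a1) / 3 * V3)‖ ≤ ‖h‖ * (2 * A / 3 * (3 * ((1 + A) * Q))) := by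
      rw [norm_mul]
      gcongr
      refine (lin3 _ _ _ _ _ _ (2 * A / 3) _ (d3 _ _ h1 h2) (d3 _ _ h2 h0) (d3 _ _ h0 h1) rfl).trans ?_
      gcongr
      linarith
    have c3 : ‖p1 * (Y - Z) + p2 * (Z - X) + p3 * (X - Y)‖ ≤ ‖h‖ * (6 * (D * (4 + A)) * Q) := by
      refine (lin3 _ _ _ _ _ _ (D * (4 + A) * (1 + N) * ‖h‖) _ bp1 bp2 bp3 rfl).trans ?_
      have : ‖Y - Z‖ + ‖Z - X‖ + ‖X - Y‖ ≤ 3 * N := by linarith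
      calc _ ≤ D * (4 + A) * (1 + N) * ‖h‖ * (6 * (1 + N)) := by gcongr; linarith
        _ = _ := by rw [hQ]; ring
    have c4 : ‖h * (φ X * (V2 - V3) + φ Y * (V3 - V1) + φ Z * (V1 - V2))‖ ≤ ‖h‖ * (6 * (1 + A) * Q) := by
      rw [norm_mul]
      gcongr
      refine (lin3 _ _ _ _ _ _ 1 _ (hφn _) (hφn _) (hφn _) rfl).trans ?_
      have q1 := norm_sub_le V2 V3
      have q2 := norm_sub_le V3 V1
      have q3 := norm_sub_le V1 V2
      linarith
    calc _ ≤ (‖h‖ * (A * (3 * Q)) + ‖h‖ * (2 * A / 3 * (3 * ((1 + A) * Q)))) +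
          A / 2 * (‖h‖ * (6 * (D * (4 + A)) * Q) + ‖h‖ * (6 * (1 + A) * Q)) := by
          refine (norm_sub_le _ _).trans (add_le_add ((norm_add_le _ _).trans (add_le_add c1 c2)) ?_)
          rw [norm_mul]
          gcongr
          exact (norm_add_le _ _).trans (add_le_add c3 c4)
      _ = _ := by ring


theorem Wc_k (φ : ℂ → ℝ) (a x : Fin 3 → ℂ) (k : Fin 3) :
    Wc φ (a 0) (a 1) (a 2) (x 0) (x 1) (x 2)
      = Wc φ (a k) (a (k + 1)) (a (k + 2)) (x k) (x (k + 1)) (x (k + 2)) := by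
  fin_cases k
  · rfl
  · exact (Wc_cyc φ (a 0) (a 1) (a 2) (x 0) (x 1) (x 2)).symm
  · exact Wc_cyc φ (a 2) (a 0) (a 1) (x 2) (x 0) (x 1)

theorem sum_k {R : Type} [AddCommMonoid R] (x : Fin 3 → R) (k : Fin 3) :
    x k + x (k + 1) + x (k + 2) = x 0 + x 1 + x 2 := by
  fin_cases k
  · rfl
  · show x 1 + x 2 + x 0 = _
    abel
  · show x 2 + x 0 + x 1 = _
    abel

theorem W_exists (a : Fin 3 → ℂ) : ∃ Wf : (Fin 3 → ℂ) → ℂ,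
    (∀ T : ℝ, ∃ K ≥ (0:ℝ), ∀ (x : ℝ → Fin 3 → ℂ) (u : ℝ) (h : ℂ),
      (∀ k, HasDerivAt (fun u => x u k) (h * (x u k * (x u (k + 1) - x u (k + 2)) + a k)) u) →
      ‖x u 0 + x u 1 + x u 2‖ ≤ T →
      ∃ d, HasDerivAt (fun u => Wf (x u)) d u ∧ ‖d‖ ≤ K * (‖Wf (x u)‖ + 1) * ‖h‖) ∧
    (∀ M T : ℝ, ∃ r > 0, ∀ (z1 : ℂ) (x : Fin 3 → ℂ), ‖Wf x‖ ≤ M → ‖x 0 + x 1 + x 2‖ ≤ T →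
      ∃ F, MSol a F (ball z1 r) ∧ (∀ k, F k z1 = x k) ∧ IsSol a F z1) := by
  obtain ⟨φ, D, hD, hφd, hφ, hφ1, hφ2, hφD, hφ0⟩ := exists_cutoff
  set A : ℝ := ∑ k, ‖a k‖ with hAdef
  have hak : ∀ k, ‖a k‖ ≤ A := fun k =>
    Finset.single_le_sum (f := fun k => ‖a k‖) (fun i _ => norm_nonneg _) (Finset.mem_univ k)
  have hA : 0 ≤ A := by positivity
  refine ⟨fun x => Wc φ (a 0) (a 1) (a 2) (x 0) (x 1) (x 2), ?_, ?_⟩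
  · intro T
    obtain ⟨K, hK, hcr⟩ := crude_deriv φ D hD hφd hφ hφD hφ0 A hA
    set T' := |T| with hT'
    have hT0 : 0 ≤ T' := abs_nonneg T
    set R := 2 * T' + 48 * A + 10 with hR
    have hR0 : 1 ≤ R := by linarith
    refine ⟨K * (1 + R) ^ 2 + 96 * K + (2 * A * (T' + 1) + 3 * A * A), by positivity, ?_⟩
    intro x u h hx ht
    have ht' : ‖x u 0 + x u 1 + x u 2‖ ≤ T' := ht.trans (le_abs_self T)
    set N := ‖x u 0‖ + ‖x u 1‖ + ‖x u 2‖ with hN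
    set w := ‖Wc φ (a 0) (a 1) (a 2) (x u 0) (x u 1) (x u 2)‖ with hw
    have hw0 : 0 ≤ w := norm_nonneg _
    have hTA : 0 ≤ 2 * A * (T' + 1) + 3 * A * A := by positivity
    by_cases hsmall : ∃ k, ‖x u k‖ < 1 ∧ R < N
    · obtain ⟨k, hk, hRN⟩ := hsmall
      obtain ⟨f1, f2, f3, f4, f5, f6, f7⟩ := fin3_facts k
      have htk : ‖x u k + x u (k + 1) + x u (k + 2)‖ ≤ T' := by rw [sum_k]; exact ht'
      have hNk : ‖x u k‖ + ‖x u (k + 1)‖ + ‖x u (k + 2)‖ = N := sum_k (fun k => ‖x u k‖) k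
      obtain ⟨l1, l2⟩ := third_large _ _ _ T' N 2 htk hNk hk (by linarith)
      have hx1 := hx (k + 1)
      have hx2 := hx (k + 2)
      rw [f4, f5] at hx1
      rw [f6, f7] at hx2
      obtain ⟨d, hd, hdb⟩ := third_deriv φ hφ1 hφ2 (a k) (a (k + 1)) (a (k + 2)) h (fun u => x u k)
        (fun u => x u (k + 1)) (fun u => x u (k + 2)) u A T' (hak _) (hak _) (hak _) htk (hx k) hx1 hx2 hk l1 l2
      refine ⟨d, ?_, hdb.trans ?_⟩
      · have : (fun u => Wc φ (a 0) (a 1) (a 2) (x u 0) (x u 1) (x u 2)) = 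
          fun u => Wc φ (a k) (a (k + 1)) (a (k + 2)) (x u k) (x u (k + 1)) (x u (k + 2)) :=
          funext fun u => Wc_k φ a (x u) k
        simp only [this]
        exact hd
      · gcongr
        have q1 : 0 ≤ K * (1 + R) ^ 2 := by positivity
        nlinarith [mul_nonneg hK hw0, mul_nonneg q1 hw0, mul_nonneg hTA hw0]
    · push Not at hsmall
      obtain ⟨d, hd, hdb⟩ := hcr (a 0) (a 1) (a 2) h (fun u => x u 0) (fun u => x u 1) (fun u => x u 2) u N
        (hak _) (hak _) (hak _) (hx 0) (hx 1) (hx 2) rfl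
      refine ⟨d, hd, hdb.trans ?_⟩
      refine mul_le_mul_of_nonneg_right ?_ (norm_nonneg _)
      have hN0 : 0 ≤ N := by positivity
      by_cases hRN : N ≤ R
      · have q1 : K * (1 + N) ^ 2 ≤ K * (1 + R) ^ 2 := by gcongr
        have q2 : 0 ≤ K * (1 + R) ^ 2 := by positivity
        nlinarith [mul_nonneg hK hw0, mul_nonneg q2 hw0, mul_nonneg hTA hw0]
      · have hbig : ∀ k, 1 ≤ ‖x u k‖ := by
          intro k
          by_contra hc
          push Not at hc
          exact hRN (hsmall k hc)
        push Not at hRN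
        have hl := Wc_lower φ hφ (a 0) (a 1) (a 2) _ _ _ A T' N (hak _) (hak _) (hak _) ht' rfl (hbig 0) (hbig 1) (hbig 2)
          (by linarith) (by linarith)
        rw [← hw] at hl
        have q1 : (1 + N) ^ 2 ≤ 96 * w := by nlinarith
        have q3 : K * (1 + N) ^ 2 ≤ K * (96 * w) := by gcongr
        have q2 : 0 ≤ K * (1 + R) ^ 2 := by positivity
        nlinarith [mul_nonneg hK hw0, mul_nonneg q2 hw0, mul_nonneg hTA hw0]
  · intro M T
    set T' := |T| with hT'
    set M' := |M| with hM'
    have hT0 : 0 ≤ T' := abs_nonneg T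
    have hM0 : 0 ≤ M' := abs_nonneg M
    set R := 6 * T' + 48 * A + 24 * M' + 20 with hR
    have hR0 : 0 < R := by positivity
    set Q := 2 * (M' + 5 * A * (T' + 2)) + A + T' + 1 with hQ
    have hAT : 0 ≤ 5 * A * (T' + 2) := by positivity
    have hQ0 : 0 < Q := by positivity
    obtain ⟨r1, hr1, h1⟩ := plain_ext a R hR0
    obtain ⟨r2, hr2, h2⟩ := pole_ext a Q hQ0
    have mono : ∀ (r : ℝ) (z1 : ℂ) (x : Fin 3 → ℂ), min r1 r2 ≤ r → (∃ F, MSol a F (ball z1 r) ∧ (∀ k, F k z1 = x k) ∧ IsSol a F z1) →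
        (∃ F, MSol a F (ball z1 (min r1 r2)) ∧ (∀ k, F k z1 = x k) ∧ IsSol a F z1) := by
      rintro r z1 x hr ⟨F, ⟨hF1, hF2⟩, hF3⟩
      have hs := ball_subset_ball (x := z1) hr
      exact ⟨F, ⟨fun k z hz => hF1 k (hs hz), fun z hz => hF2 z (hs hz)⟩, hF3⟩
    refine ⟨min r1 r2, lt_min hr1 hr2, ?_⟩
    intro z1 x hW ht
    have ht' : ‖x 0 + x 1 + x 2‖ ≤ T' := ht.trans (le_abs_self T)
    have hW' := hW.trans (le_abs_self M)
    rw [← hM'] at hW'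
    set N := ‖x 0‖ + ‖x 1‖ + ‖x 2‖ with hN
    by_cases hRN : N ≤ R
    · refine mono r1 z1 x (min_le_left _ _) (h1 z1 x fun k => ?_)
      have hNk : ‖x k‖ + ‖x (k + 1)‖ + ‖x (k + 2)‖ = N := sum_k (fun k => ‖x k‖) k
      have := norm_nonneg (x (k + 1))
      have := norm_nonneg (x (k + 2))
      linarith
    push Not at hRN
    by_cases hsmall : ∃ k, ‖x k‖ < 1
    · obtain ⟨k, hk⟩ := hsmall
      have htk : ‖x k + x (k + 1) + x (k + 2)‖ ≤ T' := by rw [sum_k]; exact ht'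
      have hNk : ‖x k‖ + ‖x (k + 1)‖ + ‖x (k + 2)‖ = N := sum_k (fun k => ‖x k‖) k
      obtain ⟨l1, l2⟩ := third_large _ _ _ T' N (2 * (T' + 1)) htk hNk hk (by linarith)
      have l3 : 2 < ‖x (k + 1)‖ := by linarith
      have l4 : 2 < ‖x (k + 2)‖ := by linarith
      simp only [Wc_k φ a x k] at hW'
      obtain ⟨b1, b2⟩ := third_chart φ hφ1 hφ2 _ _ _ _ _ _ A T' M' (hak _) (hak _) (hak _) htk hk l1 l3 l4 hW'
      refine mono r2 z1 x (min_le_right _ _) (h2 z1 x k ?_ ?_ ?_ ?_ ?_ ?_)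
      · rw [← norm_pos_iff]; linarith
      · rw [norm_inv]
        refine (inv_le_one_of_one_le₀ (by linarith)).trans ?_
        linarith
      · linarith
      · linarith
      · linarith
      · linarith
    · exfalso
      push Not at hsmall
      have hl := Wc_lower φ hφ (a 0) (a 1) (a 2) _ _ _ A T' N (hak _) (hak _) (hak _) ht' rfl (hsmall 0) (hsmall 1) (hsmall 2)
          (by linarith) (by linarith)
      have : N ^ 2 / 24 ≤ M' := hl.trans hW'
      nlinarith


theorem seg_bound (a : Fin 3 → ℂ) (Wf : (Fin 3 → ℂ) → ℂ)
    (hW : ∀ T : ℝ, ∃ K ≥ (0:ℝ), ∀ (x : ℝ → Fin 3 → ℂ) (u : ℝ) (h : ℂ),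
      (∀ k, HasDerivAt (fun u => x u k) (h * (x u k * (x u (k + 1) - x u (k + 2)) + a k)) u) →
      ‖x u 0 + x u 1 + x u 2‖ ≤ T →
      ∃ d, HasDerivAt (fun u => Wf (x u)) d u ∧ ‖d‖ ≤ K * (‖Wf (x u)‖ + 1) * ‖h‖)
    (z0 : ℂ) (x0 : Fin 3 → ℂ) (R : ℝ) :
    ∃ M T : ℝ, ∀ (G : Fin 3 → ℂ → ℂ) (z : ℂ), ‖z - z0‖ ≤ R → (∀ k, G k z0 = x0 k) →
      (∀ u ∈ Set.Icc (0:ℝ) 1, IsSol a G (z0 + (u : ℂ) * (z - z0))) →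
      ‖Wf (fun k => G k z)‖ ≤ M ∧ ‖G 0 z + G 1 z + G 2 z‖ ≤ T := by
  set T : ℝ := ‖x0 0 + x0 1 + x0 2‖ + R * ‖a 0 + a 1 + a 2‖ with hT
  obtain ⟨K, hK, hWK⟩ := hW T
  refine ⟨gronwallBound ‖Wf x0‖ (K * R) (K * R) (1 - 0), T, ?_⟩
  intro G z hz h0 hsol
  have hR : 0 ≤ R := (norm_nonneg _).trans hz
  set h := z - z0 with hh
  let x : ℝ → Fin 3 → ℂ := fun u k => G k (z0 + (u : ℂ) * h)
  have hd : ∀ s : ℝ, HasDerivAt (fun s : ℝ => z0 + (s : ℂ) * h) h s := by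
    intro s
    have := ((Complex.ofRealCLM.hasDerivAt (x := s)).mul_const h).const_add z0
    simpa using this
  have hx : ∀ u ∈ Set.Icc (0:ℝ) 1, ∀ k, HasDerivAt (fun u => x u k)
      (h * (x u k * (x u (k + 1) - x u (k + 2)) + a k)) u := by
    intro u hu k
    exact HasDerivAt.scomp u (hsol u hu k) (hd u)
  have hx0 : x 0 = x0 := by
    funext k; simp [x, h0]
  have hx1 : x 1 = fun k => G k z := by
    funext k; simp [x, hh]
  have htd : ∀ u ∈ Set.Icc (0:ℝ) 1, HasDerivAt (fun u => x u 0 + x u 1 + x u 2) (h * (a 0 + a 1 + a 2)) u := by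
    intro u hu
    have e := ((hx u hu 0).add (hx u hu 1)).add (hx u hu 2)
    refine HasDerivAt.congr_deriv e ?_
    have i1 : (1 : Fin 3) + 1 = 2 := rfl
    have i2 : (1 : Fin 3) + 2 = 0 := rfl
    have i3 : (2 : Fin 3) + 1 = 0 := rfl
    have i4 : (2 : Fin 3) + 2 = 1 := rfl
    rw [i1, i2, i3, i4, zero_add, zero_add]
    ring
  have htb : ∀ u ∈ Set.Icc (0:ℝ) 1, ‖x u 0 + x u 1 + x u 2‖ ≤ T := by
    intro u hu
    have := norm_image_sub_le_of_norm_deriv_le_segment' (C := R * ‖a 0 + a 1 + a 2‖)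
      (fun v hv => (htd v hv).hasDerivWithinAt) (fun v hv => by rw [norm_mul]; gcongr) u hu
    rw [hx0] at this
    have h3 := norm_sub_norm_le (x u 0 + x u 1 + x u 2) (x0 0 + x0 1 + x0 2)
    have h4 : R * ‖a 0 + a 1 + a 2‖ * (u - 0) ≤ R * ‖a 0 + a 1 + a 2‖ * 1 := by
      gcongr
      linarith [hu.2]
    linarith
  constructor
  · have hex : ∀ u ∈ Set.Icc (0:ℝ) 1, ∃ d, HasDerivAt (fun u => Wf (x u)) d u ∧ ‖d‖ ≤ K * (‖Wf (x u)‖ + 1) * ‖h‖ :=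
      fun u hu => hWK x u h (hx u hu) (htb u hu)
    choose! d hd1 hd2 using hex
    have := norm_le_gronwallBound_of_norm_deriv_right_le (f := fun u => Wf (x u)) (f' := d)
      (δ := ‖Wf x0‖) (K := K * R) (ε := K * R) (a := 0) (b := 1)
      (fun u hu => (hd1 u hu).continuousAt.continuousWithinAt)
      (fun u hu => (hd1 u ⟨hu.1, hu.2.le⟩).hasDerivWithinAt) (by simp [hx0]) (by
        intro u hu
        refine (hd2 u ⟨hu.1, hu.2.le⟩).trans ?_
        calc _ ≤ K * (‖Wf (x u)‖ + 1) * R := by gcongr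
          _ = _ := by ring) 1 (by simp)
    simp only [hx1] at this
    exact this
  · have := htb 1 (by simp)
    rwa [hx1] at this

theorem bad_countable (a : Fin 3 → ℂ) (G : Fin 3 → ℂ → ℂ) (B : Set ℂ) (hG : MSol a G B) :
    ({z | IsSol a G z}ᶜ ∩ B).Countable := by
  apply (HereditarilyLindelofSpace.isLindelof _).countable_of_isDiscrete
    (isDiscrete_of_codiscreteWithin _)
  rw [compl_compl, mem_codiscreteWithin]
  intro x hx
  rw [Filter.disjoint_principal_right]
  apply Filter.mem_of_superset (hG.2 x hx)
  intro w hw hw2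
  exact hw2.2 hw

theorem good_dense (a : Fin 3 → ℂ) (G : Fin 3 → ℂ → ℂ) (z0 : ℂ) (ρ : ℝ) (hG : MSol a G (ball z0 ρ))
    (h0 : IsSol a G z0) (z : ℂ) (hz : z ∈ ball z0 ρ) (ε : ℝ) (hε : 0 < ε) :
    ∃ z' ∈ ball z0 ρ, dist z' z < ε ∧ ∀ u ∈ Set.Icc (0:ℝ) 1, IsSol a G (z0 + (u : ℂ) * (z' - z0)) := by
  have hρ : 0 < ρ := pos_of_mem_ball hz
  by_cases hzz : z = z0
  · refine ⟨z0, mem_ball_self hρ, by simpa [hzz] using hε, ?_⟩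
    intro u _
    simpa using h0
  have hne : z - z0 ≠ 0 := sub_ne_zero.2 hzz
  have hc := bad_countable a G _ hG
  let q : ℂ → ℝ := fun w => ((w - z0) / (z - z0)).im / ((w - z0) / (z - z0)).re
  have hd := (hc.image q).dense_compl ℝ
  let m : ℝ → ℂ := fun τ => z + (τ : ℂ) * Complex.I * (z - z0)
  have hm : Continuous m := by fun_prop
  have hopen : IsOpen (m ⁻¹' (ball z0 ρ ∩ ball z ε)) := (isOpen_ball.inter isOpen_ball).preimage hm
  obtain ⟨τ, hτ1, hτ2⟩ := hd.inter_open_nonempty _ hopen ⟨0, by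
    simp only [Set.mem_preimage, m]
    simp only [Complex.ofReal_zero, zero_mul, add_zero]
    exact ⟨hz, mem_ball_self hε⟩⟩
  refine ⟨m τ, hτ1.1, hτ1.2, ?_⟩
  intro u hu
  by_contra hbad
  have hmem : z0 + (u : ℂ) * (m τ - z0) ∈ ball z0 ρ := by
    have h1 := hτ1.1
    rw [mem_ball, dist_eq_norm] at h1 ⊢
    rw [add_sub_cancel_left, norm_mul, Complex.norm_real, Real.norm_eq_abs, abs_of_nonneg hu.1]
    calc u * ‖m τ - z0‖ ≤ 1 * ‖m τ - z0‖ := by gcongr; exact hu.2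
      _ < ρ := by linarith
  apply hτ2
  refine ⟨z0 + (u : ℂ) * (m τ - z0), ⟨hbad, hmem⟩, ?_⟩
  have hu0 : u ≠ 0 := by
    rintro rfl
    apply hbad
    simpa using h0
  have e : (z0 + (u : ℂ) * (m τ - z0) - z0) / (z - z0) = (u : ℂ) * (1 + τ * Complex.I) := by
    simp only [m]
    field_simp
    ring
  simp only [q, e]
  simp
  field_simp

theorem MSol.mono {a : Fin 3 → ℂ} {F : Fin 3 → ℂ → ℂ} {B C : Set ℂ} (h : MSol a F B) (hs : C ⊆ B) : MSol a F C :=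
  ⟨fun k z hz => h.1 k (hs hz), fun z hz => h.2 z (hs hz)⟩

theorem MSol.ev {a : Fin 3 → ℂ} {F : Fin 3 → ℂ → ℂ} {B : Set ℂ} (h : MSol a F B) {z : ℂ} (hz : z ∈ B)
    (h1 : IsSol a F z) : ∀ᶠ w in 𝓝 z, IsSol a F w := by
  have h2 := h.2 z hz
  rw [eventually_nhdsWithin_iff] at h2
  filter_upwards [h2] with w hw
  by_cases hwz : w = z
  · rw [hwz]; exact h1
  · exact hw hwz

theorem ev_unique {a : Fin 3 → ℂ} {F G : Fin 3 → ℂ → ℂ} {z : ℂ} (hF : ∀ᶠ w in 𝓝 z, IsSol a F w)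
    (hG : ∀ᶠ w in 𝓝 z, IsSol a G w) (h : ∀ k, F k z = G k z) : ∀ᶠ w in 𝓝 z, ∀ k, F k w = G k w := by
  obtain ⟨r, hr, hb⟩ := Metric.eventually_nhds_iff_ball.1 (hF.and hG)
  have := sol_unique a F G z r (fun w hw => (hb w hw).1) (fun w hw => (hb w hw).2) h
  exact Filter.eventually_of_mem (ball_mem_nhds z hr) this

theorem msol_identity {a : Fin 3 → ℂ} {F G : Fin 3 → ℂ → ℂ} {B : Set ℂ} (hB : IsPreconnected B) (hF : MSol a F B)
    (hG : MSol a G B) {z : ℂ} (hz : z ∈ B) (h : ∀ᶠ w in 𝓝 z, ∀ k, F k w = G k w) :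
    ∀ w ∈ B, ∀ k, F k w = G k w := by
  intro w hw k
  exact nf_identity (F k) (G k) B hB (hF.1 k) (hG.1 k) z hz
    (nhdsWithin_le_nhds (h.mono fun w hw => hw k)) w hw


theorem ext_step (a : Fin 3 → ℂ) (z0 : ℂ) (x0 : Fin 3 → ℂ) (R : ℝ) :
    ∃ r > 0, ∀ ρ, 0 < ρ → ρ ≤ R → ∀ G, MSol a G (ball z0 ρ) → (∀ k, G k z0 = x0 k) → IsSol a G z0 →
      ∃ G', MSol a G' (ball z0 (r + ρ)) ∧ (∀ k, G' k z0 = x0 k) ∧ IsSol a G' z0 := by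
  obtain ⟨Wf, hW1, hW2⟩ := W_exists a
  obtain ⟨M, T, hMT⟩ := seg_bound a Wf hW1 z0 x0 R
  obtain ⟨r, hr, hext⟩ := hW2 M T
  refine ⟨r / 2, by positivity, ?_⟩
  intro ρ hρ hρR G hG hG0 hGs
  let S : Set ℂ := {z | z ∈ ball z0 ρ ∧ ∀ u ∈ Set.Icc (0:ℝ) 1, IsSol a G (z0 + (u : ℂ) * (z - z0))}
  have hS : ∀ z : S, ∃ F, MSol a F (ball (z : ℂ) r) ∧ (∀ k, F k z = G k z) ∧ IsSol a F z := by
    rintro ⟨z, hz1, hz2⟩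
    have hzR : ‖z - z0‖ ≤ R := by
      rw [mem_ball, dist_eq_norm] at hz1
      linarith
    obtain ⟨b1, b2⟩ := hMT G z hzR hG0 hz2
    exact hext z (fun k => G k z) b1 b2
  choose F hF1 hF2 hF3 using hS
  have hSG : ∀ z : S, IsSol a G z := by
    rintro ⟨z, hz1, hz2⟩
    have := hz2 1 (by simp)
    simpa using this
  have agree : ∀ z : S, ∀ w ∈ ball z0 ρ ∩ ball (z : ℂ) r, ∀ k, F z k w = G k w := by
    intro z
    have hzm : (z : ℂ) ∈ ball z0 ρ ∩ ball (z : ℂ) r := ⟨z.2.1, mem_ball_self hr⟩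
    refine msol_identity ((convex_ball _ _).inter (convex_ball _ _)).isPreconnected
      ((hF1 z).mono Set.inter_subset_right) (hG.mono Set.inter_subset_left) hzm ?_
    exact ev_unique ((hF1 z).ev hzm.2 (hF3 z)) (hG.ev hzm.1 (hSG z)) (hF2 z)
  have agree2 : ∀ z z' : S, ∀ w ∈ ball (z : ℂ) r ∩ ball (z' : ℂ) r, ∀ k, F z k w = F z' k w := by
    intro z z' w hw
    have hd : dist (z : ℂ) z' < 2 * r := by
      have h1 := hw.1
      have h2 := hw.2
      rw [mem_ball] at h1 h2
      have := dist_triangle_left (z : ℂ) z' w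
      linarith
    have hm0 : midpoint ℝ (z : ℂ) z' ∈ ball z0 ρ := (convex_ball z0 ρ).midpoint_mem z.2.1 z'.2.1
    have hm1 : midpoint ℝ (z : ℂ) z' ∈ ball (z : ℂ) r := by
      rw [mem_ball, dist_midpoint_left]
      simp
      linarith
    have hm2 : midpoint ℝ (z : ℂ) z' ∈ ball (z' : ℂ) r := by
      rw [mem_ball, dist_midpoint_right]
      simp
      linarith
    refine msol_identity ((convex_ball _ _).inter (convex_ball _ _)).isPreconnected
      ((hF1 z).mono Set.inter_subset_left) ((hF1 z').mono Set.inter_subset_right) ⟨hm1, hm2⟩ ?_ w hw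
    filter_upwards [isOpen_ball.mem_nhds hm0, isOpen_ball.mem_nhds hm1, isOpen_ball.mem_nhds hm2] with v v0 v1 v2 k
    rw [agree z v ⟨v0, v1⟩ k, agree z' v ⟨v0, v2⟩ k]
  obtain ⟨G', hG1, hG2⟩ := glue (ι := Option S) a (fun o => match o with | none => ball z0 ρ | some z => ball (z : ℂ) r)
    (fun o => match o with | none => G | some z => F z)
    (by rintro (_ | z) <;> exact isOpen_ball)
    (by rintro (_ | z); exacts [hG, hF1 z])
    (by
      rintro (_ | z) (_ | z') w hw k
      · rfl
      · exact (agree z' w hw k).symm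
      · exact agree z w ⟨hw.2, hw.1⟩ k
      · exact agree2 z z' w hw k)
  have hGG : ∀ z ∈ ball z0 ρ, ∀ k, G' k z = G k z := hG2 none
  refine ⟨G', hG1.mono ?_, ?_, ?_⟩
  · intro w hw
    rw [← thickening_ball (by positivity) hρ, mem_thickening_iff] at hw
    obtain ⟨z1, hz1, hwz⟩ := hw
    obtain ⟨z', hz', hd, hseg⟩ := good_dense a G z0 ρ hG hGs z1 hz1 (r / 2) (by positivity)
    rw [Set.mem_iUnion]
    refine ⟨some ⟨z', hz', hseg⟩, ?_⟩
    show w ∈ ball z' r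
    rw [mem_ball]
    have := dist_triangle_right w z' z1
    linarith
  · intro k
    rw [hGG z0 (mem_ball_self hρ), hG0]
  · refine isSol_congr hGs fun k => ?_
    exact Filter.eventually_of_mem (ball_mem_nhds z0 hρ) fun w hw => hGG w hw k

theorem ext_ball (a : Fin 3 → ℂ) (z0 : ℂ) (x0 : Fin 3 → ℂ) (R : ℝ) (hR : 0 < R) :
    ∃ G, MSol a G (ball z0 R) ∧ (∀ k, G k z0 = x0 k) ∧ IsSol a G z0 := by
  obtain ⟨ρ, hρ, hpl⟩ := plain_ext a (1 + ∑ k, ‖x0 k‖) (by positivity)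
  obtain ⟨G0, hG0⟩ := hpl z0 x0 (fun k => by
    have := Finset.single_le_sum (f := fun k => ‖x0 k‖) (fun i _ => norm_nonneg _) (Finset.mem_univ k)
    linarith)
  obtain ⟨r, hr, hstep⟩ := ext_step a z0 x0 R
  have key : ∀ n : ℕ, ∃ G, MSol a G (ball z0 (min (ρ + n * r) R)) ∧ (∀ k, G k z0 = x0 k) ∧ IsSol a G z0 := by
    intro n
    induction n with
    | zero => exact ⟨G0, hG0.1.mono (ball_subset_ball (by simp)), hG0.2⟩
    | succ n ih =>
      obtain ⟨G, h1, h2, h3⟩ := ih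
      obtain ⟨G', h1', h2'⟩ := hstep (min (ρ + n * r) R) (lt_min (by positivity) hR) (min_le_right _ _) G h1 h2 h3
      refine ⟨G', h1'.mono (ball_subset_ball ?_), h2'⟩
      push_cast
      rcases le_total (ρ + n * r) R with h | h
      · rw [min_eq_left h]
        refine (min_le_left _ _).trans (by linarith)
      · rw [min_eq_right h]
        refine (min_le_right _ _).trans (by linarith)
  obtain ⟨n, hn⟩ := exists_nat_gt (R / r)
  obtain ⟨G, hG⟩ := key n
  have : min (ρ + n * r) R = R := by
    apply min_eq_right
    rw [div_lt_iff₀ hr] at hn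
    linarith
  rw [this] at hG
  exact ⟨G, hG⟩

theorem global_ext (a : Fin 3 → ℂ) (z0 : ℂ) (F : Fin 3 → ℂ → ℂ) (hF : ∀ᶠ w in 𝓝 z0, IsSol a F w) :
    ∃ G, MSol a G Set.univ ∧ ∀ᶠ w in 𝓝 z0, ∀ k, G k w = F k w := by
  have h := fun n : ℕ => ext_ball a z0 (fun k => F k z0) (n + 1) (by positivity)
  choose G hG1 hG2 hG3 using h
  have hz : ∀ n : ℕ, z0 ∈ ball z0 ((n : ℝ) + 1) := fun n => mem_ball_self (by positivity)
  obtain ⟨H, hH1, hH2⟩ := glue a (fun n : ℕ => ball z0 ((n : ℝ) + 1)) G (fun _ => isOpen_ball) hG1 (by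
    intro i j
    refine msol_identity ((convex_ball _ _).inter (convex_ball _ _)).isPreconnected
      ((hG1 i).mono Set.inter_subset_left) ((hG1 j).mono Set.inter_subset_right) ⟨hz i, hz j⟩ ?_
    exact ev_unique ((hG1 i).ev (hz i) (hG3 i)) ((hG1 j).ev (hz j) (hG3 j)) (fun k => by rw [hG2, hG2]))
  refine ⟨H, hH1.mono ?_, ?_⟩
  · intro w _
    obtain ⟨n, hn⟩ := exists_nat_gt (dist w z0)
    exact Set.mem_iUnion.2 ⟨n, by rw [mem_ball]; linarith⟩
  · have e := ev_unique ((hG1 0).ev (hz 0) (hG3 0)) hF (fun k => hG2 0 k)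
    filter_upwards [e, isOpen_ball.mem_nhds (hz 0)] with w hw hw2 k
    rw [hH2 0 w hw2 k, hw k]


theorem part2 (β γ z₀ : ℂ) (w₁ w₂ : ℂ → ℂ)
    (h1 : ∀ᶠ z in 𝓝 z₀, HasDerivAt w₁ (w₂ z ^ 2 + z * w₁ z + γ) z)
    (h2 : ∀ᶠ z in 𝓝 z₀, HasDerivAt w₂ (-(w₁ z) ^ 2 - z * w₂ z - β) z) :
    ∃ W₁ W₂ : ℂ → ℂ, MeromorphicOn W₁ Set.univ ∧ MeromorphicOn W₂ Set.univ ∧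
      ∀ᶠ z in 𝓝 z₀, W₁ z = w₁ z ∧ W₂ z = w₂ z := by
  obtain ⟨κ, hκ⟩ := IsAlgClosed.exists_eq_mul_self (-3 : ℂ)
  set p : Fin 3 → ℂ := ![1, (-1 - κ) / 2, (-1 + κ) / 2] with hp
  set q : Fin 3 → ℂ := ![1, (-1 + κ) / 2, (-1 - κ) / 2] with hq
  let F : Fin 3 → ℂ → ℂ := fun k z => -κ / 3 * (p k * w₁ z + q k * w₂ z - z)
  let a : Fin 3 → ℂ := fun k => -κ / 3 * (p k * γ - q k * β - 1)
  have hF : ∀ᶠ z in 𝓝 z₀, IsSol a F z := by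
    filter_upwards [h1, h2] with z d1 d2 k
    have e := ((((d1.const_mul (p k)).add (d2.const_mul (q k))).sub (hasDerivAt_id z)).const_mul (-κ / 3))
    refine HasDerivAt.congr_deriv e ?_
    simp only [F, a]
    generalize w₁ z = Y₁
    generalize w₂ z = Y₂
    fin_cases k <;> simp [hp, hq] <;> grind
  obtain ⟨G, hG1, hG2⟩ := global_ext a z₀ F hF
  have hm : ∀ k, MeromorphicOn (G k) Set.univ := fun k => (hG1.1 k).meromorphicOn
  refine ⟨fun z => κ / 3 * (G 0 z + q 1 * G 1 z + p 1 * G 2 z), fun z => κ / 3 * (G 0 z + p 1 * G 1 z + q 1 * G 2 z), ?_, ?_, ?_⟩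
  · intro z hz
    have m0 := hm 0 z hz
    have m1 := hm 1 z hz
    have m2 := hm 2 z hz
    fun_prop
  · intro z hz
    have m0 := hm 0 z hz
    have m1 := hm 1 z hz
    have m2 := hm 2 z hz
    fun_prop
  · filter_upwards [hG2] with z hz
    simp only [hz, F]
    generalize w₁ z = Y₁
    generalize w₂ z = Y₂
    simp [hp, hq]
    constructor <;> grind

theorem mero_identity (f g : ℂ → ℂ) (B : Set ℂ) (hB : IsPreconnected B)
    (hf : MeromorphicOn f B) (hg : MeromorphicOn g B) (x : ℂ) (hx : x ∈ B)
    (h : ∀ᶠ z in 𝓝[≠] x, f z = g z) (c : ℂ) (hc : c ∈ B) : ∀ᶠ z in 𝓝[≠] c, f z = g z := by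
  have hm : MeromorphicOn (f - g) B := hf.sub hg
  have h1 : meromorphicOrderAt (f - g) x = ⊤ := by
    rw [meromorphicOrderAt_eq_top_iff]
    filter_upwards [h] with w hw
    simp [hw]
  have h2 : meromorphicOrderAt (f - g) c = ⊤ := by
    by_contra hne
    exact hm.meromorphicOrderAt_ne_top_of_isPreconnected hB hc hx hne h1
  rw [meromorphicOrderAt_eq_top_iff] at h2
  filter_upwards [h2] with w hw
  simpa [sub_eq_zero] using hw


theorem ord_lemma (f g : ℂ → ℂ) (c σ δ : ℂ) (hσ : σ ≠ 0) (hf : MeromorphicAt f c) (hg : MeromorphicAt g c)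
    (h : ∀ᶠ z in 𝓝[≠] c, g z * g z = σ * deriv f z + (-z * f z - δ)) (n : ℤ) (hn : n < 0)
    (ho : meromorphicOrderAt f c = n) : ∃ m : ℤ, meromorphicOrderAt g c = m ∧ m + m = n - 1 := by
  classical
  have h1 : meromorphicOrderAt (deriv f) c = ((n - 1 : ℤ) : WithTop ℤ) :=
    meromorphicOrderAt_deriv_eq_sub_one (by exact_mod_cast hn.ne) ho
  have h2 : meromorphicOrderAt ((fun _ => σ) * deriv f) c = ((n - 1 : ℤ) : WithTop ℤ) := by
    rw [meromorphicOrderAt_mul (MeromorphicAt.const σ c) hf.deriv, meromorphicOrderAt_const, if_neg hσ, h1, zero_add]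
  have a1 : AnalyticAt ℂ (fun z : ℂ => -z) c := by fun_prop
  have a2 : AnalyticAt ℂ (fun _ : ℂ => -δ) c := by fun_prop
  have m3 : MeromorphicAt ((fun z => -z) * f) c := a1.meromorphicAt.mul hf
  have m4 : MeromorphicAt ((fun z => -z) * f + fun _ => -δ) c := m3.add a2.meromorphicAt
  have h3 : (n : WithTop ℤ) ≤ meromorphicOrderAt ((fun z => -z) * f + fun _ => -δ) c := by
    refine le_trans (le_min ?_ ?_) (meromorphicOrderAt_add m3 a2.meromorphicAt)
    · rw [meromorphicOrderAt_mul a1.meromorphicAt hf, ho]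
      exact le_add_of_nonneg_left a1.meromorphicOrderAt_nonneg
    · exact le_trans (by exact_mod_cast hn.le) a2.meromorphicOrderAt_nonneg
  have h4 : meromorphicOrderAt ((fun _ => σ) * deriv f + ((fun z => -z) * f + fun _ => -δ)) c = ((n - 1 : ℤ) : WithTop ℤ) := by
    rw [meromorphicOrderAt_add_eq_left_of_lt m4, h2]
    rw [h2]
    refine lt_of_lt_of_le ?_ h3
    exact_mod_cast (by omega : n - 1 < n)
  have h5 : meromorphicOrderAt (g * g) c = ((n - 1 : ℤ) : WithTop ℤ) := by
    rw [← h4]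
    apply meromorphicOrderAt_congr
    filter_upwards [h] with z hz
    simp [hz]
    ring
  rw [meromorphicOrderAt_mul hg hg] at h5
  cases hm : meromorphicOrderAt g c with
  | top => rw [hm, top_add] at h5; exact absurd h5 WithTop.top_ne_coe
  | coe m =>
    rw [hm] at h5
    exact ⟨m, rfl, by exact_mod_cast h5⟩

theorem eq_of_punct {f g : ℂ → ℂ} {c : ℂ} (hf : ContinuousAt f c) (hg : ContinuousAt g c)
    (h : ∀ᶠ z in 𝓝[≠] c, f z = g z) : f c = g c :=
  ((hf.eventuallyEq_nhds_iff_eventuallyEq_nhdsNE hg).1 h).eq_of_nhds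

theorem punct_nhds {f g : ℂ → ℂ} {c : ℂ} (h : ∀ᶠ z in 𝓝[≠] c, f z = g z) :
    ∀ᶠ z in 𝓝[≠] c, f =ᶠ[𝓝 z] g := by
  have h3 := eventually_eventually_nhdsWithin.2 h
  filter_upwards [h3, self_mem_nhdsWithin] with w hw hwz
  rwa [(isOpen_compl_singleton).nhdsWithin_eq hwz] at hw

theorem local_pole (β γ c : ℂ) (Y₁ Y₂ : ℂ → ℂ) (hY₁ : MeromorphicAt Y₁ c) (hY₂ : MeromorphicAt Y₂ c)
    (h1 : ∀ᶠ z in 𝓝[≠] c, HasDerivAt Y₁ (Y₂ z ^ 2 + z * Y₁ z + γ) z)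
    (h2 : ∀ᶠ z in 𝓝[≠] c, HasDerivAt Y₂ (-(Y₁ z) ^ 2 - z * Y₂ z - β) z) :
    (∃ Z₁ Z₂ : ℂ → ℂ, AnalyticAt ℂ Z₁ c ∧ AnalyticAt ℂ Z₂ c ∧ (∀ᶠ z in 𝓝[≠] c, Y₁ z = Z₁ z) ∧
      (∀ᶠ z in 𝓝[≠] c, Y₂ z = Z₂ z)) ∨
    (∃ g₁ g₂ : ℂ → ℂ, AnalyticAt ℂ g₁ c ∧ AnalyticAt ℂ g₂ c ∧ g₁ c ^ 3 = -1 ∧ g₂ c = g₁ c ^ 2 ∧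
      (∀ᶠ z in 𝓝[≠] c, Y₁ z = (z - c)⁻¹ * g₁ z) ∧ (∀ᶠ z in 𝓝[≠] c, Y₂ z = (z - c)⁻¹ * g₂ z)) := by
  by_cases hA : 0 ≤ meromorphicOrderAt Y₁ c ∧ 0 ≤ meromorphicOrderAt Y₂ c
  · left
    exact ⟨_, _, hY₁.meromorphicOrderAt_nonneg_iff_analyticAt_toMeromorphicNFAt.1 hA.1,
      hY₂.meromorphicOrderAt_nonneg_iff_analyticAt_toMeromorphicNFAt.1 hA.2,
      hY₁.eq_nhdsNE_toMeromorphicNFAt, hY₂.eq_nhdsNE_toMeromorphicNFAt⟩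
  right
  have L1 := ord_lemma Y₁ Y₂ c 1 γ one_ne_zero hY₁ hY₂ (by
    filter_upwards [h1] with z hz
    rw [hz.deriv]; ring)
  have L2 := ord_lemma Y₂ Y₁ c (-1) β (by norm_num) hY₂ hY₁ (by
    filter_upwards [h2] with z hz
    rw [hz.deriv]; ring)
  have hneg : ∀ x : WithTop ℤ, ¬ 0 ≤ x → ∃ n : ℤ, x = n ∧ n < 0 := by
    intro x hx
    cases x with
    | top => simp at hx
    | coe n => exact ⟨n, rfl, by push Not at hx; exact_mod_cast hx⟩
  have hords : meromorphicOrderAt Y₁ c = ((-1 : ℤ) : WithTop ℤ) ∧ meromorphicOrderAt Y₂ c = ((-1 : ℤ) : WithTop ℤ) := by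
    by_cases hp : 0 ≤ meromorphicOrderAt Y₁ c
    · have hq : ¬ 0 ≤ meromorphicOrderAt Y₂ c := fun hq => hA ⟨hp, hq⟩
      obtain ⟨n, hn, hn0⟩ := hneg _ hq
      obtain ⟨m, hm, hmn⟩ := L2 n hn0 hn
      rw [hm] at hp
      have : (0 : ℤ) ≤ m := by exact_mod_cast hp
      omega
    · obtain ⟨n, hn, hn0⟩ := hneg _ hp
      obtain ⟨m, hm, hmn⟩ := L1 n hn0 hn
      obtain ⟨k, hk, hkm⟩ := L2 m (by omega) hm
      rw [hn] at hk
      have hk' : n = k := by exact_mod_cast hk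
      have e1 : n = -1 := by omega
      have e2 : m = -1 := by omega
      rw [hn, hm, e1, e2]
      exact ⟨rfl, rfl⟩
  obtain ⟨g₁, ga₁, gn₁, ge₁⟩ := (meromorphicOrderAt_eq_int_iff hY₁).1 hords.1
  obtain ⟨g₂, ga₂, gn₂, ge₂⟩ := (meromorphicOrderAt_eq_int_iff hY₂).1 hords.2
  have ge₁' : ∀ᶠ z in 𝓝[≠] c, Y₁ z = (z - c)⁻¹ * g₁ z := by
    filter_upwards [ge₁] with z hz
    rw [hz, zpow_neg_one, smul_eq_mul]
  have ge₂' : ∀ᶠ z in 𝓝[≠] c, Y₂ z = (z - c)⁻¹ * g₂ z := by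
    filter_upwards [ge₂] with z hz
    rw [hz, zpow_neg_one, smul_eq_mul]
  have dq : ∀ (Y g : ℂ → ℂ), AnalyticAt ℂ g c → (∀ᶠ z in 𝓝[≠] c, Y z = (z - c)⁻¹ * g z) →
      ∀ᶠ z in 𝓝[≠] c, deriv Y z * (z - c) ^ 2 = (z - c) * deriv g z - g z := by
    intro Y g hg he
    filter_upwards [punct_nhds he, nhdsWithin_le_nhds hg.eventually_analyticAt, self_mem_nhdsWithin] with z hz hgz hzc
    have hne : z - c ≠ 0 := sub_ne_zero.2 hzc
    have hd := (((hasDerivAt_id z).sub_const c).inv hne).mul hgz.differentiableAt.hasDerivAt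
    have hd2 : HasDerivAt Y _ z := hd.congr_of_eventuallyEq hz
    rw [hd2.deriv]
    simp
    field_simp
    ring
  have cg₁ := ga₁.continuousAt
  have cg₂ := ga₂.continuousAt
  have cd₁ := ga₁.deriv.continuousAt
  have cd₂ := ga₂.deriv.continuousAt
  have E1 := eq_of_punct (f := fun z => (z - c) * deriv g₁ z - g₁ z)
    (g := fun z => g₂ z ^ 2 + z * (z - c) * g₁ z + γ * (z - c) ^ 2) (c := c) (by fun_prop) (by fun_prop) (by
      filter_upwards [dq Y₁ g₁ ga₁ ge₁', h1, ge₁', ge₂', self_mem_nhdsWithin] with z a1 a2 a3 a4 hzc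
      have hne : z - c ≠ 0 := sub_ne_zero.2 hzc
      rw [← a1, a2.deriv, a3, a4]
      field_simp)
  have E2 := eq_of_punct (f := fun z => (z - c) * deriv g₂ z - g₂ z)
    (g := fun z => -g₁ z ^ 2 - z * (z - c) * g₂ z - β * (z - c) ^ 2) (c := c) (by fun_prop) (by fun_prop) (by
      filter_upwards [dq Y₂ g₂ ga₂ ge₂', h2, ge₁', ge₂', self_mem_nhdsWithin] with z a1 a2 a3 a4 hzc
      have hne : z - c ≠ 0 := sub_ne_zero.2 hzc
      rw [← a1, a2.deriv, a3, a4]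
      field_simp)
  simp at E1 E2
  refine ⟨g₁, g₂, ga₁, ga₂, ?_, E2, ge₁', ge₂'⟩
  rw [E2] at E1
  have : g₁ c * (g₁ c ^ 3 + 1) = 0 := by linear_combination -E1
  rcases mul_eq_zero.1 this with h | h
  · exact absurd h gn₁
  · linear_combination h


theorem main_part1 (β γ : ℂ)
    (Γ : ℝ → ℂ) (hΓc : ContinuousOn Γ (Set.Icc 0 1))
    (U : Set ℂ) (hU : IsOpen U) (hΓU : Γ '' Set.Ico 0 1 ⊆ U)
    (y₁ y₂ : ℂ → ℂ) (hy₁ : AnalyticOnNhd ℂ y₁ U) (hy₂ : AnalyticOnNhd ℂ y₂ U)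
    (hode : ∀ z ∈ U,
      deriv y₁ z = y₂ z ^ 2 + z * y₁ z + γ ∧
      deriv y₂ z = -(y₁ z) ^ 2 - z * y₂ z - β)
    (hsing : ¬ ∃ (V : Set ℂ) (Y₁ Y₂ : ℂ → ℂ), IsOpen V ∧ Γ 1 ∈ V ∧
      AnalyticOnNhd ℂ Y₁ V ∧ AnalyticOnNhd ℂ Y₂ V ∧
      (∀ z ∈ V,
        deriv Y₁ z = Y₂ z ^ 2 + z * Y₁ z + γ ∧
        deriv Y₂ z = -(Y₁ z) ^ 2 - z * Y₂ z - β) ∧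
      ∃ δ > (0 : ℝ), ∀ s : ℝ, 1 - δ < s → s < 1 →
        Y₁ (Γ s) = y₁ (Γ s) ∧ Y₂ (Γ s) = y₂ (Γ s)) :
    (∃ r > (0 : ℝ), ∃ Y₁ Y₂ : ℂ → ℂ, ∃ c₁ c₂ : ℕ → ℂ,
      c₁ 0 ^ 3 = -1 ∧ c₂ 0 = c₁ 0 ^ 2 ∧
      AnalyticOnNhd ℂ Y₁ (ball (Γ 1) r \ {Γ 1}) ∧
      AnalyticOnNhd ℂ Y₂ (ball (Γ 1) r \ {Γ 1}) ∧
      (∀ z ∈ ball (Γ 1) r \ {Γ 1},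
        deriv Y₁ z = Y₂ z ^ 2 + z * Y₁ z + γ ∧
        deriv Y₂ z = -(Y₁ z) ^ 2 - z * Y₂ z - β) ∧
      (∀ z ∈ ball (Γ 1) r \ {Γ 1},
        HasSum (fun k : ℕ => c₁ k * (z - Γ 1) ^ k) ((z - Γ 1) * Y₁ z) ∧
        HasSum (fun k : ℕ => c₂ k * (z - Γ 1) ^ k) ((z - Γ 1) * Y₂ z)) ∧
      ∃ δ > (0 : ℝ), ∀ s : ℝ, 1 - δ < s → s < 1 →
        Y₁ (Γ s) = y₁ (Γ s) ∧ Y₂ (Γ s) = y₂ (Γ s)) := by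
  have hcU : Γ 1 ∉ U := fun h => hsing ⟨U, y₁, y₂, hU, h, hy₁, hy₂, hode, 1, one_pos,
    fun _ _ _ => ⟨rfl, rfl⟩⟩
  have hS : ∀ s, 0 ≤ s → s < 1 → Γ s ∈ U := fun s h0 h1 => hΓU ⟨s, ⟨h0, h1⟩, rfl⟩
  have h0U : Γ 0 ∈ U := hS 0 le_rfl one_pos
  have hyd1 : ∀ z ∈ U, HasDerivAt y₁ (y₂ z ^ 2 + z * y₁ z + γ) z := fun z hz => by
    rw [← (hode z hz).1]; exact (hy₁ z hz).differentiableAt.hasDerivAt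
  have hyd2 : ∀ z ∈ U, HasDerivAt y₂ (-(y₁ z) ^ 2 - z * y₂ z - β) z := fun z hz => by
    rw [← (hode z hz).2]; exact (hy₂ z hz).differentiableAt.hasDerivAt
  have hU0 : ∀ᶠ z in 𝓝 (Γ 0), z ∈ U := hU.mem_nhds h0U
  obtain ⟨Y₁, Y₂, hM1, hM2, hYy⟩ := part2 β γ (Γ 0) y₁ y₂
    (hU0.mono hyd1) (hU0.mono hyd2)
  have hE1 : ∀ᶠ z in 𝓝 (Γ 0), Y₁ =ᶠ[𝓝 z] y₁ := by
    filter_upwards [eventually_eventually_nhds.2 hYy] with z hz using hz.mono fun _ h => h.1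
  have hE2 : ∀ᶠ z in 𝓝 (Γ 0), Y₂ =ᶠ[𝓝 z] y₂ := by
    filter_upwards [eventually_eventually_nhds.2 hYy] with z hz using hz.mono fun _ h => h.2
  have hid : MeromorphicOn (fun z : ℂ => z) Set.univ := fun z _ => MeromorphicAt.id z
  have hcst : ∀ a : ℂ, MeromorphicOn (fun _ : ℂ => a) Set.univ := fun a z _ => MeromorphicAt.const a z
  have m1 : MeromorphicOn (fun z => Y₂ z ^ 2 + z * Y₁ z + γ) Set.univ := fun z hz =>
    (((hM2 z hz).pow 2).add ((hid z hz).mul (hM1 z hz))).add (hcst γ z hz)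
  have m2 : MeromorphicOn (fun z => -(Y₁ z) ^ 2 - z * Y₂ z - β) Set.univ := fun z hz =>
    ((((hM1 z hz).pow 2).neg).sub ((hid z hz).mul (hM2 z hz))).sub (hcst β z hz)
  have O1 : ∀ c : ℂ, ∀ᶠ z in 𝓝[≠] c, HasDerivAt Y₁ (Y₂ z ^ 2 + z * Y₁ z + γ) z := by
    intro c
    have h := mero_identity (deriv Y₁) _ Set.univ isPreconnected_univ
      (fun z hz => (hM1 z hz).deriv) m1 (Γ 0) trivial (by
        apply Filter.Eventually.filter_mono nhdsWithin_le_nhds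
        filter_upwards [hE1, hYy, hU0] with z h1 h2 h3
        rw [h1.deriv_eq, h2.1, h2.2, (hode z h3).1]) c trivial
    filter_upwards [h, (hM1 c trivial).eventually_analyticAt] with z hz ha
    rw [← hz]; exact ha.differentiableAt.hasDerivAt
  have O2 : ∀ c : ℂ, ∀ᶠ z in 𝓝[≠] c, HasDerivAt Y₂ (-(Y₁ z) ^ 2 - z * Y₂ z - β) z := by
    intro c
    have h := mero_identity (deriv Y₂) _ Set.univ isPreconnected_univ
      (fun z hz => (hM2 z hz).deriv) m2 (Γ 0) trivial (by
        apply Filter.Eventually.filter_mono nhdsWithin_le_nhds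
        filter_upwards [hE2, hYy, hU0] with z h1 h2 h3
        rw [h1.deriv_eq, h2.1, h2.2, (hode z h3).2]) c trivial
    filter_upwards [h, (hM2 c trivial).eventually_analyticAt] with z hz ha
    rw [← hz]; exact ha.differentiableAt.hasDerivAt
  -- agreement along the curve
  set V := connectedComponentIn U (Γ 0) with hV
  have hVU : V ⊆ U := connectedComponentIn_subset U (Γ 0)
  have hVp : IsPreconnected V := isPreconnected_connectedComponentIn
  have h0V : Γ 0 ∈ V := mem_connectedComponentIn h0U
  have hSV : ∀ s, 0 ≤ s → s < 1 → Γ s ∈ V := by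
    intro s h0 h1
    have hp : IsPreconnected (Γ '' Set.Ico 0 1) :=
      isPreconnected_Ico.image Γ (hΓc.mono Set.Ico_subset_Icc_self)
    exact hp.subset_connectedComponentIn ⟨0, ⟨le_rfl, one_pos⟩, rfl⟩ hΓU ⟨s, ⟨h0, h1⟩, rfl⟩
  have A1 : ∀ z ∈ V, ∀ᶠ w in 𝓝[≠] z, Y₁ w = y₁ w := fun z hz =>
    mero_identity Y₁ y₁ V hVp (fun w _ => hM1 w trivial)
      (fun w hw => (hy₁ w (hVU hw)).meromorphicAt) (Γ 0) h0V
      (Filter.Eventually.filter_mono nhdsWithin_le_nhds (hYy.mono fun _ h => h.1)) z hz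
  have A2 : ∀ z ∈ V, ∀ᶠ w in 𝓝[≠] z, Y₂ w = y₂ w := fun z hz =>
    mero_identity Y₂ y₂ V hVp (fun w _ => hM2 w trivial)
      (fun w hw => (hy₂ w (hVU hw)).meromorphicAt) (Γ 0) h0V
      (Filter.Eventually.filter_mono nhdsWithin_le_nhds (hYy.mono fun _ h => h.2)) z hz
  have agree : ∀ (r : ℝ) (_ : 0 < r) (Z₁ Z₂ : ℂ → ℂ),
      (∀ z ∈ ball (Γ 1) r \ {Γ 1}, AnalyticAt ℂ Z₁ z) →
      (∀ z ∈ ball (Γ 1) r \ {Γ 1}, AnalyticAt ℂ Z₂ z) →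
      (∀ z ∈ ball (Γ 1) r \ {Γ 1}, Y₁ z = Z₁ z ∧ Y₂ z = Z₂ z) →
      ∃ δ > (0 : ℝ), ∀ s : ℝ, 1 - δ < s → s < 1 →
        Z₁ (Γ s) = y₁ (Γ s) ∧ Z₂ (Γ s) = y₂ (Γ s) := by
    intro r hr Z₁ Z₂ a1 a2 he
    obtain ⟨δ, hδ, hb⟩ := Metric.continuousWithinAt_iff.1
      (hΓc 1 ⟨zero_le_one, le_rfl⟩) r hr
    refine ⟨min δ 1, lt_min hδ one_pos, fun s hs1 hs2 => ?_⟩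
    have l1 := min_le_left δ 1
    have l2 := min_le_right δ 1
    have hs0 : 0 ≤ s := by linarith
    have hbs : Γ s ∈ ball (Γ 1) r := hb ⟨hs0, hs2.le⟩ (by
      rw [Real.dist_eq, abs_lt]; constructor <;> linarith)
    have hv := hSV s hs0 hs2
    have hne : Γ s ≠ Γ 1 := fun h => hcU (h ▸ hVU hv)
    have hmem : Γ s ∈ ball (Γ 1) r \ {Γ 1} := ⟨hbs, hne⟩
    have hop : ∀ᶠ w in 𝓝[≠] (Γ s), w ∈ ball (Γ 1) r \ {Γ 1} :=
      nhdsWithin_le_nhds ((isOpen_ball.sdiff isClosed_singleton).mem_nhds hmem)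
    constructor
    · refine eq_of_punct (a1 _ hmem).continuousAt (hy₁ _ (hVU hv)).continuousAt ?_
      filter_upwards [hop, A1 _ hv] with w h1 h2
      rw [← h2, (he w h1).1]
    · refine eq_of_punct (a2 _ hmem).continuousAt (hy₂ _ (hVU hv)).continuousAt ?_
      filter_upwards [hop, A2 _ hv] with w h1 h2
      rw [← h2, (he w h1).2]
  have exball : ∀ P : ℂ → Prop, (∀ᶠ z in 𝓝[≠] (Γ 1), P z) →
      ∃ r > (0:ℝ), ∀ z ∈ ball (Γ 1) r \ {Γ 1}, P z := by
    intro P hP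
    obtain ⟨r, hr, h⟩ := Metric.mem_nhdsWithin_iff.1 hP
    exact ⟨r, hr, fun z hz => h ⟨hz.1, hz.2⟩⟩
  rcases local_pole β γ (Γ 1) Y₁ Y₂ (hM1 _ trivial) (hM2 _ trivial) (O1 _) (O2 _) with
    ⟨Z₁, Z₂, z1, z2, e⟩ | ⟨g₁, g₂, z1, z2, hc1, hc2, e⟩
  · exfalso
    apply hsing
    have e1 : ∀ᶠ z in 𝓝[≠] (Γ 1), Y₁ z = Z₁ z := e.1
    have e2 : ∀ᶠ z in 𝓝[≠] (Γ 1), Y₂ z = Z₂ z := e.2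
    have d1 : ∀ᶠ z in 𝓝[≠] (Γ 1), deriv Z₁ z = Z₂ z ^ 2 + z * Z₁ z + γ := by
      filter_upwards [e1, e2, punct_nhds e1, O1 (Γ 1)] with z h1 h2 h3 h4
      rw [← h3.deriv_eq, h4.deriv, h1, h2]
    have d2 : ∀ᶠ z in 𝓝[≠] (Γ 1), deriv Z₂ z = -(Z₁ z) ^ 2 - z * Z₂ z - β := by
      filter_upwards [e1, e2, punct_nhds e2, O2 (Γ 1)] with z h1 h2 h3 h4
      rw [← h3.deriv_eq, h4.deriv, h1, h2]
    have c1 := z1.continuousAt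
    have c2 := z2.continuousAt
    have D1 : deriv Z₁ (Γ 1) = Z₂ (Γ 1) ^ 2 + Γ 1 * Z₁ (Γ 1) + γ :=
      eq_of_punct (g := fun z => Z₂ z ^ 2 + z * Z₁ z + γ) z1.deriv.continuousAt (by fun_prop) d1
    have D2 : deriv Z₂ (Γ 1) = -(Z₁ (Γ 1)) ^ 2 - Γ 1 * Z₂ (Γ 1) - β :=
      eq_of_punct (g := fun z => -(Z₁ z) ^ 2 - z * Z₂ z - β) z2.deriv.continuousAt (by fun_prop) d2
    obtain ⟨r, hr, hb⟩ := exball _ ((e.1.and e.2).and (d1.and (d2.and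
      (nhdsWithin_le_nhds (z1.eventually_analyticAt.and z2.eventually_analyticAt)))))
    have hsplit : ∀ z ∈ ball (Γ 1) r, z = Γ 1 ∨ z ∈ ball (Γ 1) r \ {Γ 1} := fun z hz => by
      by_cases h : z = Γ 1
      · exact Or.inl h
      · exact Or.inr ⟨hz, h⟩
    refine ⟨ball (Γ 1) r, Z₁, Z₂, isOpen_ball, mem_ball_self hr, ?_, ?_, ?_,
      agree r hr Z₁ Z₂ (fun z hz => (hb z hz).2.2.2.1) (fun z hz => (hb z hz).2.2.2.2)
        (fun z hz => (hb z hz).1)⟩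
    · intro z hz
      rcases hsplit z hz with rfl | h
      · exact z1
      · exact (hb z h).2.2.2.1
    · intro z hz
      rcases hsplit z hz with rfl | h
      · exact z2
      · exact (hb z h).2.2.2.2
    · intro z hz
      rcases hsplit z hz with rfl | h
      · exact ⟨D1, D2⟩
      · exact ⟨(hb z h).2.1, (hb z h).2.2.1⟩
  · obtain ⟨p₁, hp₁⟩ := id z1
    obtain ⟨p₂, hp₂⟩ := id z2
    have s1 := hp₁.eventually_hasSum_sub
    have s2 := hp₂.eventually_hasSum_sub
    have e1 : ∀ᶠ z in 𝓝[≠] (Γ 1), Y₁ z = (z - Γ 1)⁻¹ * g₁ z := e.1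
    have e2 : ∀ᶠ z in 𝓝[≠] (Γ 1), Y₂ z = (z - Γ 1)⁻¹ * g₂ z := e.2
    have d1 : ∀ᶠ z in 𝓝[≠] (Γ 1), deriv (fun z => (z - Γ 1)⁻¹ * g₁ z) z =
        ((z - Γ 1)⁻¹ * g₂ z) ^ 2 + z * ((z - Γ 1)⁻¹ * g₁ z) + γ := by
      filter_upwards [e1, e2, punct_nhds e1, O1 (Γ 1)] with z h1 h2 h3 h4
      rw [← h3.deriv_eq, h4.deriv, h1, h2]
    have d2 : ∀ᶠ z in 𝓝[≠] (Γ 1), deriv (fun z => (z - Γ 1)⁻¹ * g₂ z) z =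
        -((z - Γ 1)⁻¹ * g₁ z) ^ 2 - z * ((z - Γ 1)⁻¹ * g₂ z) - β := by
      filter_upwards [e1, e2, punct_nhds e2, O2 (Γ 1)] with z h1 h2 h3 h4
      rw [← h3.deriv_eq, h4.deriv, h1, h2]
    obtain ⟨r, hr, hb⟩ := exball _ ((e.1.and e.2).and (d1.and (d2.and
      (nhdsWithin_le_nhds ((z1.eventually_analyticAt.and z2.eventually_analyticAt).and (s1.and s2))))))
    have an : ∀ g : ℂ → ℂ, ∀ z, z ≠ Γ 1 → AnalyticAt ℂ g z →
        AnalyticAt ℂ (fun z => (z - Γ 1)⁻¹ * g z) z := fun g z hz hg =>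
      ((analyticAt_id.sub analyticAt_const).inv (sub_ne_zero.2 hz)).mul hg
    have B1 : ∀ z ∈ ball (Γ 1) r \ {Γ 1}, AnalyticAt ℂ (fun z => (z - Γ 1)⁻¹ * g₁ z) z :=
      fun z hz => an _ _ hz.2 (hb z hz).2.2.2.1.1
    have B2 : ∀ z ∈ ball (Γ 1) r \ {Γ 1}, AnalyticAt ℂ (fun z => (z - Γ 1)⁻¹ * g₂ z) z :=
      fun z hz => an _ _ hz.2 (hb z hz).2.2.2.1.2
    have k1 : p₁.coeff 0 = g₁ (Γ 1) := hp₁.coeff_zero _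
    have k2 : p₂.coeff 0 = g₂ (Γ 1) := hp₂.coeff_zero _
    refine ⟨r, hr, fun z => (z - Γ 1)⁻¹ * g₁ z, fun z => (z - Γ 1)⁻¹ * g₂ z,
      fun k => p₁.coeff k, fun k => p₂.coeff k, ?_, ?_, B1, B2,
      fun z hz => ⟨(hb z hz).2.1, (hb z hz).2.2.1⟩, ?_, agree r hr _ _ B1 B2 (fun z hz => (hb z hz).1)⟩
    · simp only [k1]; exact hc1
    · simp only [k1, k2]; exact hc2
    · intro z hz
      have hz0 : z - Γ 1 ≠ 0 := sub_ne_zero.2 hz.2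
      simp only [mul_inv_cancel_left₀ hz0]
      have t := (hb z hz).2.2.2.2
      simpa only [FormalMultilinearSeries.apply_eq_pow_smul_coeff, smul_eq_mul, mul_comm] using t

/-- The case `M = N = 2`: for the Hamiltonian system `y₁' = y₂² + z y₁ + γ`,
`y₂' = −y₁² − z y₂ − β` every movable singularity `z_∞`, reached by analytic
continuation along a finite-length curve, is a simple pole of both `y₁` and `y₂`,
around which the solution extends to the punctured disc and is given by convergent
Laurent series `y_i = ∑_{k ≥ −1} C_{i,k}(z−z_∞)^k` with `C_{1,−1}³ = −1`,
`C_{2,−1} = C_{1,−1}²`; moreover every local solution of the system extends to a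
pair of functions meromorphic on all of `ℂ` (the Painlevé property). -/
theorem painleve_property_M2N2 (β γ : ℂ)
    (Γ : ℝ → ℂ) (hΓc : ContinuousOn Γ (Set.Icc 0 1))
    (hlen : eVariationOn Γ (Set.Icc 0 1) ≠ ⊤)
    (U : Set ℂ) (hU : IsOpen U) (hΓU : Γ '' Set.Ico 0 1 ⊆ U)
    (y₁ y₂ : ℂ → ℂ) (hy₁ : AnalyticOnNhd ℂ y₁ U) (hy₂ : AnalyticOnNhd ℂ y₂ U)
    (hode : ∀ z ∈ U,
      deriv y₁ z = y₂ z ^ 2 + z * y₁ z + γ ∧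
      deriv y₂ z = -(y₁ z) ^ 2 - z * y₂ z - β)
    -- the solution cannot be continued analytically to the endpoint `z_∞ = Γ 1`
    (hsing : ¬ ∃ (V : Set ℂ) (Y₁ Y₂ : ℂ → ℂ), IsOpen V ∧ Γ 1 ∈ V ∧
      AnalyticOnNhd ℂ Y₁ V ∧ AnalyticOnNhd ℂ Y₂ V ∧
      (∀ z ∈ V,
        deriv Y₁ z = Y₂ z ^ 2 + z * Y₁ z + γ ∧
        deriv Y₂ z = -(Y₁ z) ^ 2 - z * Y₂ z - β) ∧
      ∃ δ > (0 : ℝ), ∀ s : ℝ, 1 - δ < s → s < 1 →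
        Y₁ (Γ s) = y₁ (Γ s) ∧ Y₂ (Γ s) = y₂ (Γ s)) :
    -- `z_∞ = Γ 1` is a simple pole of both components
    (∃ r > (0 : ℝ), ∃ Y₁ Y₂ : ℂ → ℂ, ∃ c₁ c₂ : ℕ → ℂ,
      c₁ 0 ^ 3 = -1 ∧ c₂ 0 = c₁ 0 ^ 2 ∧
      AnalyticOnNhd ℂ Y₁ (ball (Γ 1) r \ {Γ 1}) ∧
      AnalyticOnNhd ℂ Y₂ (ball (Γ 1) r \ {Γ 1}) ∧
      (∀ z ∈ ball (Γ 1) r \ {Γ 1},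
        deriv Y₁ z = Y₂ z ^ 2 + z * Y₁ z + γ ∧
        deriv Y₂ z = -(Y₁ z) ^ 2 - z * Y₂ z - β) ∧
      (∀ z ∈ ball (Γ 1) r \ {Γ 1},
        HasSum (fun k : ℕ => c₁ k * (z - Γ 1) ^ k) ((z - Γ 1) * Y₁ z) ∧
        HasSum (fun k : ℕ => c₂ k * (z - Γ 1) ^ k) ((z - Γ 1) * Y₂ z)) ∧
      ∃ δ > (0 : ℝ), ∀ s : ℝ, 1 - δ < s → s < 1 →
        Y₁ (Γ s) = y₁ (Γ s) ∧ Y₂ (Γ s) = y₂ (Γ s)) ∧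
    -- the Painlevé property: every local solution extends meromorphically to `ℂ`
    (∀ (z₀ : ℂ) (ρ : ℝ), 0 < ρ →
      ∀ w₁ w₂ : ℂ → ℂ,
        AnalyticOnNhd ℂ w₁ (ball z₀ ρ) → AnalyticOnNhd ℂ w₂ (ball z₀ ρ) →
        (∀ z ∈ ball z₀ ρ,
          deriv w₁ z = w₂ z ^ 2 + z * w₁ z + γ ∧
          deriv w₂ z = -(w₁ z) ^ 2 - z * w₂ z - β) →
        ∃ W₁ W₂ : ℂ → ℂ,
          MeromorphicOn W₁ Set.univ ∧ MeromorphicOn W₂ Set.univ ∧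
          ∀ᶠ z in 𝓝 z₀, W₁ z = w₁ z ∧ W₂ z = w₂ z) := by
  refine ⟨main_part1 β γ Γ hΓc U hU hΓU y₁ y₂ hy₁ hy₂ hode hsing, ?_⟩
  intro z₀ ρ hρ w₁ w₂ h1 h2 h
  have hb : ∀ᶠ z in 𝓝 z₀, z ∈ ball z₀ ρ := ball_mem_nhds z₀ hρ
  refine part2 β γ z₀ w₁ w₂ (hb.mono fun z hz => ?_) (hb.mono fun z hz => ?_)
  · rw [← (h z hz).1]
    exact (h1 z hz).differentiableAt.hasDerivAt
  · rw [← (h z hz).2]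
    exact (h2 z hz).differentiableAt.hasDerivAt
end

section
/- Let β, γ ∈ ℂ be constants and let (y₁, y₂) be a solution of the system y₁' = y₂² + z y₁ + γ, y₂' = −y₁² − z y₂ − β on a domain. Then y = y₁ satisfies the second-order second-degree differential equation (y'' + z y' − (1 + 2z²) y − 2γz)² = 4 (y² + β)² (y' − z y − γ). -/
/-- If `(y₁, y₂)` solves the Hamiltonian system
`y₁' = y₂² + z y₁ + γ`, `y₂' = −y₁² − z y₂ − β` on a domain `U`,
then `y = y₁` satisfies the second-order second-degree equation
`(y'' + z y' − (1 + 2z²) y − 2γz)² = 4 (y² + β)² (y' − z y − γ)` on `U`. -/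
theorem second_order_second_degree_equation (β γ : ℂ)
    (U : Set ℂ) (hU : IsOpen U) (hUconn : IsPreconnected U)
    (y₁ y₂ : ℂ → ℂ)
    (hy₁ : DifferentiableOn ℂ y₁ U) (hy₂ : DifferentiableOn ℂ y₂ U)
    (hode : ∀ z ∈ U,
      deriv y₁ z = (y₂ z) ^ 2 + z * y₁ z + γ ∧
      deriv y₂ z = -(y₁ z) ^ 2 - z * y₂ z - β) :
    ∀ z ∈ U,
      (deriv (deriv y₁) z + z * deriv y₁ z - (1 + 2 * z ^ 2) * y₁ z - 2 * γ * z) ^ 2 =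
        4 * ((y₁ z) ^ 2 + β) ^ 2 * (deriv y₁ z - z * y₁ z - γ) := by
  intro z hz
  have hn : U ∈ nhds z := hU.mem_nhds hz
  have h1 : HasDerivAt y₁ (deriv y₁ z) z := (hy₁.differentiableAt hn).hasDerivAt
  have h2 : HasDerivAt y₂ (deriv y₂ z) z := (hy₂.differentiableAt hn).hasDerivAt
  have he : deriv y₁ =ᶠ[nhds z] fun w => (y₂ w) ^ 2 + w * y₁ w + γ := by
    filter_upwards [hn] with w hw using (hode w hw).1
  have h3 : HasDerivAt (fun w => (y₂ w) ^ 2 + w * y₁ w + γ)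
      (2 * y₂ z * deriv y₂ z + (1 * y₁ z + z * deriv y₁ z)) z := by
    have := ((h2.fun_pow 2).fun_add ((hasDerivAt_id' z).fun_mul h1)).add_const γ
    simpa using this
  rw [he.deriv_eq, h3.deriv, (hode z hz).2, (hode z hz).1]
  ring
end
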